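/- arXiv:2210.02788 — 4 statements merged into one kernel-verified Lean document; each statement's English description precedes it below -/
import Mathlib

section
/- (Corollary 5.6.) Assume the hypotheses: E is a differential field extension of K with differential constants λ, μ algebraically independent over K, a fundamental matrix Ψ ∈ M_ℓ(E) for L − λ exists, and L̂ ∘ B̂ = B̂ ∘ L̂ on E^ℓ. (1) If B̂ = R(L̂) on E^ℓ for some polynomial R ∈ C[λ], then M(L−λ, B−μ) + μ I_ℓ = R(λ)·I_ℓ in M_ℓ(E), f(λ,μ) = (R(λ) − μ)^ℓ, and BC = (μ − R(λ)). (2) If f = (μ − R(λ))^ℓ up to a unit and f ∈ BC, then BC = ((μ − R(λ))^r) for the minimal r with (μ − R(λ))^r ∈ BC, 1 ≤ r ≤ ℓ; in particular, if r = 1 then B̂ = R(L̂). -/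
open Matrix Polynomial Finset

/-- A derivation-like map on a commutative ring: additive and satisfying the Leibniz rule. -/
def IsDeriv {R : Type*} [CommRing R] (d : R → R) : Prop :=
  (∀ a b, d (a + b) = d a + d b) ∧ (∀ a b, d (a * b) = d a * b + a * d b)

/-- The recursively defined matrices `p_j(N)`:
`p_0(N) = 1`, `p_{j+1}(N) = p_j(N) * N + (p_j(N))'`. -/
def pMat {R : Type*} [CommRing R] (d : R → R) {l : ℕ}
    (N : Matrix (Fin l) (Fin l) R) : ℕ → Matrix (Fin l) (Fin l) R
  | 0 => 1
  | j + 1 => pMat d N j * N + (pMat d N j).map d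

/-- Entrywise derivative of a vector. -/
def dVec {R : Type*} (d : R → R) {l : ℕ} (v : Fin l → R) : Fin l → R :=
  fun i => d (v i)

/-- Entrywise derivative of a matrix. -/
def dMat {R : Type*} (d : R → R) {l : ℕ} (A : Matrix (Fin l) (Fin l) R) :
    Matrix (Fin l) (Fin l) R :=
  A.map d

/-- Action of the first-order operator `P = A₀ + A₁ D` on vectors with entries in a
differential extension `E` of `K` (with embedding `ι` and derivation `dE`). -/
def opP {K E : Type*} [CommRing K] [CommRing E] (ι : K →+* E) (dE : E → E) {l : ℕ}
    (A0 A1 : Matrix (Fin l) (Fin l) K) (ψ : Fin l → E) : Fin l → E :=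
  (A0.map ι).mulVec ψ + (A1.map ι).mulVec (dVec dE ψ)

/-- Action of the operator `Q = Σ_{j=0}^n B_j D^j` on vectors with entries in a
differential extension `E` of `K`. -/
def opQ {K E : Type*} [CommRing K] [CommRing E] (ι : K →+* E) (dE : E → E) {l : ℕ}
    (n : ℕ) (Bc : ℕ → Matrix (Fin l) (Fin l) K) (ψ : Fin l → E) : Fin l → E :=
  ∑ j ∈ Finset.range (n + 1), ((Bc j).map ι).mulVec ((dVec dE)^[j] ψ)

/-- Columnwise action of `Q = Σ_{j=0}^n B_j D^j` on matrices. -/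
def opQMat {K E : Type*} [CommRing K] [CommRing E] (ι : K →+* E) (dE : E → E) {l : ℕ}
    (n : ℕ) (Bc : ℕ → Matrix (Fin l) (Fin l) K) (Ψ : Matrix (Fin l) (Fin l) E) :
    Matrix (Fin l) (Fin l) E :=
  ∑ j ∈ Finset.range (n + 1), (Bc j).map ι * (dMat dE)^[j] Ψ

/-- The matrix `M(P,Q) = Σ_{j=0}^n B_j p_j(N)` with `N = -A₁⁻¹A₀`. -/
noncomputable def MPQ {K : Type*} [Field K] (dK : K → K) {l : ℕ}
    (n : ℕ) (A0 A1 : Matrix (Fin l) (Fin l) K) (Bc : ℕ → Matrix (Fin l) (Fin l) K) :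
    Matrix (Fin l) (Fin l) K :=
  ∑ j ∈ Finset.range (n + 1), Bc j * pMat dK (-(A1⁻¹ * A0)) j

/-- Coefficientwise extension of a derivation to polynomials (the variable is a constant). -/
noncomputable def dPoly {K : Type*} [CommRing K] (d : K → K) (p : Polynomial K) : Polynomial K :=
  p.sum fun n a => Polynomial.C (d a) * Polynomial.X ^ n

/-- `N_λ = -A₁⁻¹ (A₀ - λ·1)` as a matrix over `K[λ]`. -/
noncomputable def Nlam {K : Type*} [Field K] {l : ℕ} (A0 A1 : Matrix (Fin l) (Fin l) K) :
    Matrix (Fin l) (Fin l) (Polynomial K) :=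
  -((A1⁻¹).map (Polynomial.C : K →+* Polynomial K) *
      (A0.map (Polynomial.C : K →+* Polynomial K)
        - (Polynomial.X : Polynomial K) • (1 : Matrix (Fin l) (Fin l) (Polynomial K))))

/-- `M(L-λ, B-μ) = Σ_{j=0}^n B_j p_j(N_λ) - μ·1` as a matrix over `K[λ][μ]`
(inner variable `λ`, outer variable `μ`). -/
noncomputable def Mspec {K : Type*} [Field K] (dK : K → K) {l : ℕ}
    (n : ℕ) (A0 A1 : Matrix (Fin l) (Fin l) K) (Bc : ℕ → Matrix (Fin l) (Fin l) K) :
    Matrix (Fin l) (Fin l) (Polynomial (Polynomial K)) :=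
  (∑ j ∈ Finset.range (n + 1),
      (Bc j).map (Polynomial.C.comp Polynomial.C : K →+* Polynomial (Polynomial K)) *
        (pMat (dPoly dK) (Nlam A0 A1) j).map
          (Polynomial.C : Polynomial K →+* Polynomial (Polynomial K)))
    - (Polynomial.X : Polynomial (Polynomial K)) •
        (1 : Matrix (Fin l) (Fin l) (Polynomial (Polynomial K)))

/-- The differential resultant `f(λ,μ) = det M(L-λ, B-μ)` as an element of `K[λ][μ]`. -/
noncomputable def fSpec {K : Type*} [Field K] (dK : K → K) {l : ℕ}
    (n : ℕ) (A0 A1 : Matrix (Fin l) (Fin l) K) (Bc : ℕ → Matrix (Fin l) (Fin l) K) :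
    Polynomial (Polynomial K) :=
  (Mspec dK n A0 A1 Bc).det

/-- Evaluation `K[λ][μ] → E` at `λ = a`, `μ = b` (through `ι : K →+* E`). -/
noncomputable def evalLM {K E : Type*} [CommRing K] [CommRing E] (ι : K →+* E) (a b : E) :
    Polynomial (Polynomial K) →+* E :=
  Polynomial.eval₂RingHom (Polynomial.eval₂RingHom ι a) b

/-- `N_λ` with `λ` specialized to an element `lam` of an extension `E`. -/
noncomputable def NlamE {K E : Type*} [Field K] [CommRing E] (ι : K →+* E) (lam : E) {l : ℕ}
    (A0 A1 : Matrix (Fin l) (Fin l) K) : Matrix (Fin l) (Fin l) E :=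
  -((A1⁻¹).map ι * (A0.map ι - lam • 1))

/-- `g(L,B)` applied to `ψ`, for `g` a polynomial in two variables over `C₀`
(inner variable `λ` substituted by `Lh`, outer variable `μ` substituted by `Bh`). -/
noncomputable def applyPoly {C₀ E : Type*} [CommRing C₀] [CommRing E] (ιc : C₀ →+* E) {l : ℕ}
    (Lh Bh : (Fin l → E) → (Fin l → E)) (g : Polynomial (Polynomial C₀)) (ψ : Fin l → E) :
    Fin l → E :=
  ∑ i ∈ Finset.range (g.natDegree + 1),
    ∑ k ∈ Finset.range ((g.coeff i).natDegree + 1),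
      ιc ((g.coeff i).coeff k) • Lh^[k] (Bh^[i] ψ)


theorem End_add_apply {V : Type*} [AddCommGroup V] (S T : AddMonoid.End V) (v : V) :
    (S + T) v = S v + T v := rfl

theorem End_sub_apply {V : Type*} [AddCommGroup V] (S T : AddMonoid.End V) (v : V) :
    (S - T) v = S v - T v := rfl

theorem End_sum_apply {V : Type*} [AddCommGroup V] {α : Type*} (s : Finset α)
    (f : α → AddMonoid.End V) (v : V) :
    (∑ i ∈ s, f i) v = ∑ i ∈ s, f i v :=
  AddMonoidHom.finsetSum_apply (fun i => (f i : V →+ V)) s v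

theorem End_mul_apply {V : Type*} [AddCommGroup V] (S T : AddMonoid.End V) (v : V) :
    (S * T) v = S (T v) := rfl

theorem IsDeriv.zero' {R : Type*} [CommRing R] {d : R → R} (h : IsDeriv d) : d 0 = 0 := by
  have := h.1 0 0
  simpa using this

theorem IsDeriv.one' {R : Type*} [CommRing R] {d : R → R} (h : IsDeriv d) : d 1 = 0 := by
  have := h.2 1 1
  simpa using this

def Dh {E : Type*} [CommRing E] {dE : E → E} (hdE : IsDeriv dE) (l : ℕ) :
    AddMonoid.End (Fin l → E) :=
  AddMonoidHom.mk' (dVec dE) (fun a b => by ext i; simp [dVec, hdE.1])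

theorem Dh_apply {E : Type*} [CommRing E] {dE : E → E} (hdE : IsDeriv dE) (l : ℕ)
    (v : Fin l → E) : Dh hdE l v = dVec dE v := rfl

def matE {E : Type*} [CommRing E] {l : ℕ} (M : Matrix (Fin l) (Fin l) E) :
    AddMonoid.End (Fin l → E) :=
  (Matrix.mulVecLin M).toAddMonoidHom

theorem matE_apply {E : Type*} [CommRing E] {l : ℕ} (M : Matrix (Fin l) (Fin l) E)
    (v : Fin l → E) : matE M v = M *ᵥ v := rfl

theorem matE_mul {E : Type*} [CommRing E] {l : ℕ} (M N : Matrix (Fin l) (Fin l) E) :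
    matE (M * N) = matE M * matE N := by
  ext v : 1
  simp [matE_apply, End_mul_apply, Matrix.mulVec_mulVec]

theorem matE_add {E : Type*} [CommRing E] {l : ℕ} (M N : Matrix (Fin l) (Fin l) E) :
    matE (M + N) = matE M + matE N := by
  ext v : 1
  simp [matE_apply, End_add_apply, Matrix.add_mulVec]

theorem matE_zero {E : Type*} [CommRing E] {l : ℕ} :
    matE (0 : Matrix (Fin l) (Fin l) E) = 0 := by
  ext v : 1
  simp [matE_apply]

theorem matE_one {E : Type*} [CommRing E] {l : ℕ} :
    matE (1 : Matrix (Fin l) (Fin l) E) = 1 := by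
  ext v : 1
  simp [matE_apply]

theorem IsDeriv.sum' {R : Type*} [CommRing R] {d : R → R} (h : IsDeriv d) {α : Type*}
    (s : Finset α) (f : α → R) : d (∑ i ∈ s, f i) = ∑ i ∈ s, d (f i) :=
  map_sum (AddMonoidHom.mk' d h.1) f s

theorem Dh_matE {E : Type*} [CommRing E] {dE : E → E} (hdE : IsDeriv dE) {l : ℕ}
    (M : Matrix (Fin l) (Fin l) E) :
    Dh hdE l * matE M = matE (M.map dE) + matE M * Dh hdE l := by
  ext v i
  simp only [End_mul_apply, End_add_apply, matE_apply, Dh_apply]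
  simp [Pi.add_apply, dVec, Matrix.mulVec, dotProduct, hdE.sum', hdE.2, Finset.sum_add_distrib]

/-- `L` as an additive endomorphism. -/
def Lh {K E : Type*} [CommRing K] [CommRing E] (ι : K →+* E) {dE : E → E} (hdE : IsDeriv dE)
    {l : ℕ} (A0 A1 : Matrix (Fin l) (Fin l) K) : AddMonoid.End (Fin l → E) :=
  matE (A0.map ι) + matE (A1.map ι) * Dh hdE l

def Bh {K E : Type*} [CommRing K] [CommRing E] (ι : K →+* E) {dE : E → E} (hdE : IsDeriv dE)
    {l : ℕ} (n : ℕ) (Bc : ℕ → Matrix (Fin l) (Fin l) K) : AddMonoid.End (Fin l → E) :=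
  ∑ j ∈ Finset.range (n + 1), matE ((Bc j).map ι) * Dh hdE l ^ j

theorem Lh_coe {K E : Type*} [CommRing K] [CommRing E] (ι : K →+* E) {dE : E → E}
    (hdE : IsDeriv dE) {l : ℕ} (A0 A1 : Matrix (Fin l) (Fin l) K) :
    ⇑(Lh ι hdE A0 A1) = opP ι dE A0 A1 := rfl

theorem Bh_coe {K E : Type*} [CommRing K] [CommRing E] (ι : K →+* E) {dE : E → E}
    (hdE : IsDeriv dE) {l : ℕ} (n : ℕ) (Bc : ℕ → Matrix (Fin l) (Fin l) K) :
    ⇑(Bh ι hdE n Bc) = opQ ι dE n Bc := by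
  ext1 v
  simp only [Bh, opQ]
  rw [End_sum_apply]
  refine Finset.sum_congr rfl fun j _ => ?_
  rw [End_mul_apply, matE_apply, AddMonoid.End.coe_pow]
  rfl

/-- Scalars as endomorphisms. -/
def scE (E : Type*) [CommRing E] (l : ℕ) : E →+* AddMonoid.End (Fin l → E) :=
  Module.toAddMonoidEnd E (Fin l → E)

theorem scE_apply {E : Type*} [CommRing E] {l : ℕ} (c : E) (v : Fin l → E) :
    scE E l c v = c • v := rfl

theorem scE_matE {E : Type*} [CommRing E] {l : ℕ} (c : E) (M : Matrix (Fin l) (Fin l) E) :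
    Commute (scE E l c) (matE M) := by
  ext v : 1
  simp [End_mul_apply, scE_apply, matE_apply, Matrix.mulVec_smul]

theorem scE_Dh {E : Type*} [CommRing E] {dE : E → E} (hdE : IsDeriv dE) {l : ℕ} {c : E}
    (hc : dE c = 0) : Commute (scE E l c) (Dh hdE l) := by
  ext v i
  simp only [End_mul_apply, scE_apply, Dh_apply]
  simp [dVec, hdE.2, hc]

theorem scE_Lh {K E : Type*} [CommRing K] [CommRing E] (ι : K →+* E) {dE : E → E}
    (hdE : IsDeriv dE) {l : ℕ} (A0 A1 : Matrix (Fin l) (Fin l) K) {c : E} (hc : dE c = 0) :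
    Commute (scE E l c) (Lh ι hdE A0 A1) :=
  (scE_matE _ _).add_right ((scE_matE _ _).mul_right (scE_Dh hdE hc))

theorem scE_Bh {K E : Type*} [CommRing K] [CommRing E] (ι : K →+* E) {dE : E → E}
    (hdE : IsDeriv dE) {l : ℕ} (n : ℕ) (Bc : ℕ → Matrix (Fin l) (Fin l) K) {c : E}
    (hc : dE c = 0) :
    Commute (scE E l c) (Bh ι hdE n Bc) :=
  Commute.sum_right _ _ _ fun _ _ =>
    ((scE_matE _ _).mul_right ((scE_Dh hdE hc).pow_right _))

/-- `ρ₁ : C₀[λ] → End`. -/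
noncomputable def rho1 {C₀ E : Type*} [CommRing C₀] [CommRing E] {l : ℕ} (ic : C₀ →+* E)
    (L : AddMonoid.End (Fin l → E)) (hL : ∀ c, Commute (scE E l (ic c)) L) :
    C₀[X] →+* AddMonoid.End (Fin l → E) :=
  Polynomial.eval₂RingHom' ((scE E l).comp ic) L hL

theorem rho1_comm {C₀ E : Type*} [CommRing C₀] [CommRing E] {l : ℕ} (ic : C₀ →+* E)
    (L : AddMonoid.End (Fin l → E)) (hL : ∀ c, Commute (scE E l (ic c)) L)
    (B : AddMonoid.End (Fin l → E)) (hB : ∀ c, Commute (scE E l (ic c)) B)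
    (hLB : Commute L B) (p : C₀[X]) : Commute (rho1 ic L hL p) B := by
  induction p using Polynomial.induction_on' with
  | add p q hp hq => rw [map_add]; exact hp.add_left hq
  | monomial k a =>
    simp only [rho1, eval₂RingHom', RingHom.coe_mk, MonoidHom.coe_mk, OneHom.coe_mk,
      eval₂_monomial]
    exact (hB a).mul_left (hLB.pow_left k)

noncomputable def rho {C₀ E : Type*} [CommRing C₀] [CommRing E] {l : ℕ} (ic : C₀ →+* E)
    (L : AddMonoid.End (Fin l → E)) (hL : ∀ c, Commute (scE E l (ic c)) L)
    (B : AddMonoid.End (Fin l → E)) (hB : ∀ c, Commute (scE E l (ic c)) B)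
    (hLB : Commute L B) : C₀[X][X] →+* AddMonoid.End (Fin l → E) :=
  Polynomial.eval₂RingHom' (rho1 ic L hL) B (rho1_comm ic L hL B hB hLB)

theorem rho1_apply {C₀ E : Type*} [CommRing C₀] [CommRing E] {l : ℕ} (ic : C₀ →+* E)
    (L : AddMonoid.End (Fin l → E)) (hL : ∀ c, Commute (scE E l (ic c)) L)
    (p : C₀[X]) (v : Fin l → E) :
    rho1 ic L hL p v = ∑ k ∈ Finset.range (p.natDegree + 1), ic (p.coeff k) • L^[k] v := by
  simp only [rho1, eval₂RingHom', RingHom.coe_mk, MonoidHom.coe_mk, OneHom.coe_mk,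
    eval₂_eq_sum_range]
  rw [End_sum_apply]
  refine Finset.sum_congr rfl fun j _ => ?_
  rw [End_mul_apply, AddMonoid.End.coe_pow]
  rfl

theorem rho_apply {C₀ E : Type*} [CommRing C₀] [CommRing E] {l : ℕ} (ic : C₀ →+* E)
    (L : AddMonoid.End (Fin l → E)) (hL : ∀ c, Commute (scE E l (ic c)) L)
    (B : AddMonoid.End (Fin l → E)) (hB : ∀ c, Commute (scE E l (ic c)) B)
    (hLB : Commute L B) (g : C₀[X][X]) (v : Fin l → E) :
    rho ic L hL B hB hLB g v = applyPoly ic L B g v := by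
  simp only [rho, eval₂RingHom', RingHom.coe_mk, MonoidHom.coe_mk, OneHom.coe_mk,
    eval₂_eq_sum_range, applyPoly]
  rw [End_sum_apply]
  refine Finset.sum_congr rfl fun j _ => ?_
  rw [End_mul_apply, AddMonoid.End.coe_pow, rho1_apply]

theorem rho_C {C₀ E : Type*} [CommRing C₀] [CommRing E] {l : ℕ} (ic : C₀ →+* E)
    (L : AddMonoid.End (Fin l → E)) (hL : ∀ c, Commute (scE E l (ic c)) L)
    (B : AddMonoid.End (Fin l → E)) (hB : ∀ c, Commute (scE E l (ic c)) B)
    (hLB : Commute L B) (p : C₀[X]) :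
    rho ic L hL B hB hLB (C p) = rho1 ic L hL p := by
  simp [rho, eval₂RingHom']

theorem rho_X {C₀ E : Type*} [CommRing C₀] [CommRing E] {l : ℕ} (ic : C₀ →+* E)
    (L : AddMonoid.End (Fin l → E)) (hL : ∀ c, Commute (scE E l (ic c)) L)
    (B : AddMonoid.End (Fin l → E)) (hB : ∀ c, Commute (scE E l (ic c)) B)
    (hLB : Commute L B) :
    rho ic L hL B hB hLB X = B := by
  simp [rho, eval₂RingHom']

theorem rho1_eig {C₀ E : Type*} [CommRing C₀] [CommRing E] {l : ℕ} (ic : C₀ →+* E)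
    (L : AddMonoid.End (Fin l → E)) (hL : ∀ c, Commute (scE E l (ic c)) L)
    (p : C₀[X]) (v : Fin l → E) (lam : E) (hlam : ∀ k, L^[k] v = lam ^ k • v) :
    rho1 ic L hL p v = eval₂ ic lam p • v := by
  rw [rho1_apply, eval₂_eq_sum_range, Finset.sum_smul]
  simp [hlam, smul_smul]

theorem Lpow_eig {E : Type*} [CommRing E] {l : ℕ} (L : AddMonoid.End (Fin l → E))
    (v : Fin l → E) (lam : E) (hc : Commute (scE E l lam) L) (h : L v = lam • v) (k : ℕ) :
    L^[k] v = lam ^ k • v := by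
  induction k with
  | zero => simp
  | succ k ih =>
    rw [Function.iterate_succ_apply', ih, ← scE_apply, map_pow, ← End_mul_apply,
      ← (hc.pow_left k).eq, End_mul_apply, h, ← map_pow, scE_apply, smul_smul, pow_succ]

/-- Normal forms `∑ S_j L^j`. -/
noncomputable def Phi {K E : Type*} [CommRing K] [CommRing E] (ι : K →+* E) {l : ℕ}
    (L : AddMonoid.End (Fin l → E)) :
    Polynomial (Matrix (Fin l) (Fin l) K) →+ AddMonoid.End (Fin l → E) :=
  AddMonoidHom.mk' (fun S => S.sum fun j M => matE (M.map ι) * L ^ j) (fun a b => by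
    apply Polynomial.sum_add_index
    · intro i; simp [matE_zero]
    · intro i M N
      rw [Matrix.map_add _ (map_add ι), matE_add, add_mul])

theorem Phi_monomial {K E : Type*} [CommRing K] [CommRing E] (ι : K →+* E) {l : ℕ}
    (L : AddMonoid.End (Fin l → E)) (j : ℕ) (M : Matrix (Fin l) (Fin l) K) :
    Phi ι L (monomial j M) = matE (M.map ι) * L ^ j := by
  simp only [Phi, AddMonoidHom.mk'_apply]
  apply Polynomial.sum_monomial_index
  simp [matE_zero]

theorem mat_mem {K E : Type*} [CommRing K] [CommRing E] (ι : K →+* E) {l : ℕ}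
    (L : AddMonoid.End (Fin l → E)) (M : Matrix (Fin l) (Fin l) K)
    {T : AddMonoid.End (Fin l → E)} (hT : T ∈ (Phi ι L).range) :
    matE (M.map ι) * T ∈ (Phi ι L).range := by
  obtain ⟨S, rfl⟩ := hT
  induction S using Polynomial.induction_on' with
  | add p q hp hq => rw [map_add, mul_add]; exact add_mem hp hq
  | monomial k a =>
    refine ⟨monomial k (M * a), ?_⟩
    rw [Phi_monomial, Phi_monomial, Matrix.map_mul, matE_mul, mul_assoc]

theorem Dh_eq {K E : Type*} [Field K] [CommRing E] (ι : K →+* E) {dE : E → E}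
    (hdE : IsDeriv dE) {l : ℕ} (A0 A1 : Matrix (Fin l) (Fin l) K) (hA1 : IsUnit A1.det) :
    Dh hdE l = matE ((A1⁻¹).map ι) * (Lh ι hdE A0 A1 - matE (A0.map ι)) := by
  rw [Lh, add_sub_cancel_left, ← mul_assoc, ← matE_mul, ← Matrix.map_mul,
    Matrix.nonsing_inv_mul _ hA1]
  simp [matE_one]

theorem Dh_mem {K E : Type*} [Field K] [CommRing E] (ι : K →+* E) {dK : K → K} {dE : E → E}
    (hdE : IsDeriv dE) (hcomp : ∀ a : K, dE (ι a) = ι (dK a))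
    {l : ℕ} (A0 A1 : Matrix (Fin l) (Fin l) K) (hA1 : IsUnit A1.det)
    {T : AddMonoid.End (Fin l → E)} (hT : T ∈ (Phi ι (Lh ι hdE A0 A1)).range) :
    Dh hdE l * T ∈ (Phi ι (Lh ι hdE A0 A1)).range := by
  obtain ⟨S, rfl⟩ := hT
  induction S using Polynomial.induction_on' with
  | add p q hp hq => rw [map_add, mul_add]; exact add_mem hp hq
  | monomial k a =>
    have h1 : ∀ j (M : Matrix (Fin l) (Fin l) K), matE (M.map ι) * Lh ι hdE A0 A1 ^ j ∈
        (Phi ι (Lh ι hdE A0 A1)).range := fun j M => ⟨_, Phi_monomial _ _ _ _⟩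
    rw [Phi_monomial, ← mul_assoc, Dh_matE, add_mul]
    have h2 : (a.map ι).map dE = (a.map dK).map ι := by ext i j; simp [hcomp]
    rw [h2]
    refine add_mem (h1 _ _) ?_
    rw [mul_assoc]
    apply mat_mem
    rw [Dh_eq ι hdE A0 A1 hA1, mul_assoc]
    apply mat_mem
    rw [sub_mul, ← pow_succ']
    refine sub_mem ?_ (h1 _ _)
    simpa [matE_one] using h1 (k + 1) 1

theorem Lh_mem {K E : Type*} [Field K] [CommRing E] (ι : K →+* E) {dK : K → K} {dE : E → E}
    (hdE : IsDeriv dE) (hcomp : ∀ a : K, dE (ι a) = ι (dK a))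
    {l : ℕ} (A0 A1 : Matrix (Fin l) (Fin l) K) (hA1 : IsUnit A1.det)
    {T : AddMonoid.End (Fin l → E)} (hT : T ∈ (Phi ι (Lh ι hdE A0 A1)).range) :
    Lh ι hdE A0 A1 * T ∈ (Phi ι (Lh ι hdE A0 A1)).range := by
  rw [show Lh ι hdE A0 A1 * T = matE (A0.map ι) * T + matE (A1.map ι) * (Dh hdE l * T) by
    rw [Lh, add_mul, mul_assoc]]
  exact add_mem (mat_mem _ _ _ hT) (mat_mem _ _ _ (Dh_mem ι hdE hcomp A0 A1 hA1 hT))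

theorem Bh_mem {K E : Type*} [Field K] [CommRing E] (ι : K →+* E) {dK : K → K} {dE : E → E}
    (hdE : IsDeriv dE) (hcomp : ∀ a : K, dE (ι a) = ι (dK a))
    {l : ℕ} (A0 A1 : Matrix (Fin l) (Fin l) K) (hA1 : IsUnit A1.det)
    (n : ℕ) (Bc : ℕ → Matrix (Fin l) (Fin l) K)
    {T : AddMonoid.End (Fin l → E)} (hT : T ∈ (Phi ι (Lh ι hdE A0 A1)).range) :
    Bh ι hdE n Bc * T ∈ (Phi ι (Lh ι hdE A0 A1)).range := by
  rw [Bh, Finset.sum_mul]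
  refine sum_mem fun j hj => ?_
  rw [mul_assoc]
  apply mat_mem
  clear hj
  induction j with
  | zero => simpa using hT
  | succ j ih => rw [pow_succ', mul_assoc]; exact Dh_mem ι hdE hcomp A0 A1 hA1 ih

theorem rho_mem {K E C₀ : Type*} [Field K] [CommRing E] [CommRing C₀] (ι : K →+* E)
    {dK : K → K} {dE : E → E}
    (hdE : IsDeriv dE) (hcomp : ∀ a : K, dE (ι a) = ι (dK a))
    {l : ℕ} (A0 A1 : Matrix (Fin l) (Fin l) K) (hA1 : IsUnit A1.det)
    (n : ℕ) (Bc : ℕ → Matrix (Fin l) (Fin l) K) (jC : C₀ →+* K)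
    (hL : ∀ c, Commute (scE E l ((ι.comp jC) c)) (Lh ι hdE A0 A1))
    (hB : ∀ c, Commute (scE E l ((ι.comp jC) c)) (Bh ι hdE n Bc))
    (hLB : Commute (Lh ι hdE A0 A1) (Bh ι hdE n Bc)) (g : C₀[X][X]) :
    rho (ι.comp jC) _ hL _ hB hLB g ∈ (Phi ι (Lh ι hdE A0 A1)).range := by
  have hsc : ∀ c : C₀, scE E l ((ι.comp jC) c) = matE ((jC c • (1 : Matrix (Fin l) (Fin l) K)).map ι) := by
    intro c
    ext v i
    have : (jC c • (1 : Matrix (Fin l) (Fin l) K)).map ι = ι (jC c) • 1 := by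
      ext i j; simp [Matrix.one_apply, apply_ite ι]
    rw [matE_apply, this, scE_apply, Matrix.smul_mulVec]
    simp
  induction g using Polynomial.induction_on' with
  | add p q hp hq => rw [map_add]; exact add_mem hp hq
  | monomial k a =>
    rw [← C_mul_X_pow_eq_monomial, map_mul, map_pow, rho_X, rho_C]
    induction a using Polynomial.induction_on' with
    | add p q hp hq => rw [map_add, add_mul]; exact add_mem hp hq
    | monomial m c =>
      rw [rho1, eval₂RingHom'_apply, eval₂_monomial, RingHom.comp_apply, hsc, mul_assoc]
      apply mat_mem
      have hk : Bh ι hdE n Bc ^ k ∈ (Phi ι (Lh ι hdE A0 A1)).range := by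
        induction k with
        | zero => exact ⟨monomial 0 1, by rw [Phi_monomial]; simp [matE_one]⟩
        | succ k ih => rw [pow_succ']; exact Bh_mem ι hdE hcomp A0 A1 hA1 n Bc ih
      induction m with
      | zero => simpa using hk
      | succ m ih => rw [pow_succ', mul_assoc]; exact Lh_mem ι hdE hcomp A0 A1 hA1 ih

theorem mat_eq_zero {E : Type*} [CommRing E] {l : ℕ} (Ψ M : Matrix (Fin l) (Fin l) E)
    (hΨ : IsUnit Ψ.det) (h : ∀ k, M *ᵥ (fun i => Ψ i k) = 0) : M = 0 := by
  have : M * Ψ = 0 := by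
    ext i k
    exact congrFun (h k) i
  calc M = M * Ψ * Ψ⁻¹ := by rw [mul_assoc, Matrix.mul_nonsing_inv _ hΨ, mul_one]
    _ = 0 := by rw [this, zero_mul]

theorem Phi_eig {K E : Type*} [Field K] [CommRing E] (ι : K →+* E) {l : ℕ}
    (L : AddMonoid.End (Fin l → E)) (lam : E) (v : Fin l → E)
    (heig : ∀ j, L^[j] v = lam ^ j • v)
    (S : Polynomial (Matrix (Fin l) (Fin l) K)) :
    Phi ι L S v = ((matPolyEquiv.symm S).map (eval₂RingHom ι lam)) *ᵥ v := by
  induction S using Polynomial.induction_on' with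
  | add p q hp hq =>
    rw [map_add, End_add_apply, map_add, Matrix.map_add _ (map_add _), Matrix.add_mulVec, hp, hq]
  | monomial m M =>
    rw [Phi_monomial, End_mul_apply, AddMonoid.End.coe_pow, heig, matE_apply]
    have : (matPolyEquiv.symm (monomial m M)).map (eval₂RingHom ι lam) = lam ^ m • M.map ι := by
      ext i j
      have e : matPolyEquiv.symm (monomial m M) i j = monomial m (M i j) := by
        ext k
        rw [matPolyEquiv_symm_apply_coeff, coeff_monomial, coeff_monomial]
        split_ifs <;> rfl
      rw [Matrix.map_apply, e]
      simp [mul_comm]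
    rw [this, Matrix.smul_mulVec, Matrix.mulVec_smul]

theorem Phi_inj {K E : Type*} [Field K] [CommRing E] (ι : K →+* E) {l : ℕ}
    (L : AddMonoid.End (Fin l → E)) (lam : E)
    (htr : ∀ p : K[X], eval₂ ι lam p = 0 → p = 0)
    (Ψ : Matrix (Fin l) (Fin l) E) (hΨ : IsUnit Ψ.det)
    (heig : ∀ j k, L^[j] (fun i => Ψ i k) = lam ^ j • (fun i => Ψ i k))
    (T : AddMonoid.End (Fin l → E)) (hT : T ∈ (Phi ι L).range)
    (h0 : ∀ k, T (fun i => Ψ i k) = 0) : T = 0 := by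
  obtain ⟨S, rfl⟩ := hT
  have hz := mat_eq_zero Ψ _ hΨ
    (fun k => (Phi_eig ι L lam _ (fun j => heig j k) S).symm.trans (h0 k))
  have : matPolyEquiv.symm S = 0 := by
    ext1 i j
    exact htr _ (congrFun (congrFun hz i) j)
  have : S = 0 := by simpa using this
  rw [this, map_zero]

theorem dPoly_add {K : Type*} [CommRing K] {d : K → K} (hd : IsDeriv d) (p q : K[X]) :
    dPoly d (p + q) = dPoly d p + dPoly d q := by
  apply Polynomial.sum_add_index
  · intro i; simp [hd.zero']
  · intro i a b; rw [hd.1, map_add, add_mul]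

theorem dPoly_monomial {K : Type*} [CommRing K] {d : K → K} (hd : IsDeriv d) (k : ℕ) (a : K) :
    dPoly d (monomial k a) = monomial k (d a) := by
  rw [← C_mul_X_pow_eq_monomial (a := d a)]
  apply Polynomial.sum_monomial_index
  simp [hd.zero']

theorem IsDeriv.pow_const {R : Type*} [CommRing R] {d : R → R} (h : IsDeriv d) {a : R}
    (ha : d a = 0) (k : ℕ) : d (a ^ k) = 0 := by
  induction k with
  | zero => simp [h.one']
  | succ k ih => rw [pow_succ, h.2, ih, ha]; simp

theorem dE_eval {K E : Type*} [CommRing K] [CommRing E] {ι : K →+* E}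
    {dK : K → K} (hdK : IsDeriv dK) {dE : E → E}
    (hdE : IsDeriv dE) (hcomp : ∀ a : K, dE (ι a) = ι (dK a)) {lam : E} (hlam : dE lam = 0)
    (p : K[X]) : dE (eval₂ ι lam p) = eval₂ ι lam (dPoly dK p) := by
  induction p using Polynomial.induction_on' with
  | add p q hp hq => rw [eval₂_add, hdE.1, hp, hq, dPoly_add hdK, eval₂_add]
  | monomial k a =>
    rw [dPoly_monomial hdK, eval₂_monomial, eval₂_monomial, hdE.2, hdE.pow_const hlam, hcomp,
      mul_zero, add_zero]

theorem dE_eval_const {K E C₀ : Type*} [CommRing K] [CommRing E] [CommRing C₀] {ι : K →+* E}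
    {dK : K → K} {dE : E → E}
    (hdE : IsDeriv dE) (hcomp : ∀ a : K, dE (ι a) = ι (dK a)) {lam : E} (hlam : dE lam = 0)
    (jC : C₀ →+* K) (hjc : ∀ c, dK (jC c) = 0)
    (p : C₀[X]) : dE (eval₂ (ι.comp jC) lam p) = 0 := by
  induction p using Polynomial.induction_on' with
  | add p q hp hq => rw [eval₂_add, hdE.1, hp, hq, add_zero]
  | monomial k a =>
    rw [eval₂_monomial, hdE.2, hdE.pow_const hlam, RingHom.comp_apply, hcomp, hjc]
    simp

theorem Nlam_map {K E : Type*} [Field K] [CommRing E] (ι : K →+* E) (lam : E) {l : ℕ}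
    (A0 A1 : Matrix (Fin l) (Fin l) K) :
    (Nlam A0 A1).map (eval₂RingHom ι lam) = NlamE ι lam A0 A1 := by
  have h : ∀ M : Matrix (Fin l) (Fin l) K,
      (M.map (C : K →+* K[X])).map (eval₂RingHom ι lam) = M.map ι := by
    intro M; ext i j; simp
  have h2 : ((X : K[X]) • (1 : Matrix (Fin l) (Fin l) K[X])).map (eval₂RingHom ι lam) =
      lam • 1 := by
    ext i j
    by_cases hij : i = j <;> simp [Matrix.one_apply, hij]
  rw [Nlam, NlamE, Matrix.map_neg _ (map_neg _), Matrix.map_mul, Matrix.map_sub _ (map_sub _), h,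
    h, h2]

theorem pMat_map {K E : Type*} [Field K] [CommRing E] {ι : K →+* E}
    {dK : K → K} (hdK : IsDeriv dK) {dE : E → E}
    (hdE : IsDeriv dE) (hcomp : ∀ a : K, dE (ι a) = ι (dK a)) {lam : E} (hlam : dE lam = 0)
    {l : ℕ} (A0 A1 : Matrix (Fin l) (Fin l) K) (j : ℕ) :
    (pMat (dPoly dK) (Nlam A0 A1) j).map (eval₂RingHom ι lam) =
      pMat dE (NlamE ι lam A0 A1) j := by
  induction j with
  | zero => simp [pMat]
  | succ j ih =>
    rw [pMat, pMat, Matrix.map_add _ (map_add _), Matrix.map_mul, Nlam_map, ih, ← ih]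
    congr 1
    ext i k
    simp [dE_eval hdK hdE hcomp hlam]

theorem Dh_pow_eig {E : Type*} [CommRing E] {dE : E → E} (hdE : IsDeriv dE) {l : ℕ}
    (N : Matrix (Fin l) (Fin l) E) (v : Fin l → E) (hv : Dh hdE l v = N *ᵥ v) (j : ℕ) :
    (Dh hdE l ^ j) v = pMat dE N j *ᵥ v := by
  induction j with
  | zero => simp [pMat]
  | succ j ih =>
    rw [pow_succ', End_mul_apply, ih, ← matE_apply, ← End_mul_apply, Dh_matE, End_add_apply,
      End_mul_apply, hv, matE_apply, matE_apply, pMat, Matrix.add_mulVec, Matrix.mulVec_mulVec,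
      add_comm]

/-- The matrix `∑ B_j p_j(N_λ)` over `E`. -/
noncomputable def ME {K E : Type*} [Field K] [CommRing E] (ι : K →+* E) (dE : E → E) (lam : E)
    {l : ℕ} (A0 A1 : Matrix (Fin l) (Fin l) K) (n : ℕ) (Bc : ℕ → Matrix (Fin l) (Fin l) K) :
    Matrix (Fin l) (Fin l) E :=
  ∑ j ∈ Finset.range (n + 1), (Bc j).map ι * pMat dE (NlamE ι lam A0 A1) j

theorem Bh_eig {K E : Type*} [Field K] [CommRing E] (ι : K →+* E) {dE : E → E}
    (hdE : IsDeriv dE) (lam : E)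
    {l : ℕ} (A0 A1 : Matrix (Fin l) (Fin l) K) (n : ℕ) (Bc : ℕ → Matrix (Fin l) (Fin l) K)
    (v : Fin l → E) (hv : Dh hdE l v = NlamE ι lam A0 A1 *ᵥ v) :
    Bh ι hdE n Bc v = ME ι dE lam A0 A1 n Bc *ᵥ v := by
  rw [Bh, End_sum_apply, ME, Matrix.sum_mulVec]
  refine Finset.sum_congr rfl fun j _ => ?_
  rw [End_mul_apply, Dh_pow_eig hdE _ v hv, matE_apply, Matrix.mulVec_mulVec]

theorem Lh_eig {K E : Type*} [Field K] [CommRing E] (ι : K →+* E) {dE : E → E}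
    (hdE : IsDeriv dE) (lam : E)
    {l : ℕ} (A0 A1 : Matrix (Fin l) (Fin l) K) (hA1 : IsUnit A1.det)
    (v : Fin l → E) (hv : Dh hdE l v = NlamE ι lam A0 A1 *ᵥ v) :
    Lh ι hdE A0 A1 v = lam • v := by
  rw [Lh, End_add_apply, End_mul_apply, hv, matE_apply, matE_apply, Matrix.mulVec_mulVec,
    ← Matrix.add_mulVec, NlamE, mul_neg, ← mul_assoc, ← Matrix.map_mul,
    Matrix.mul_nonsing_inv _ hA1]
  simp [Matrix.smul_mulVec]

theorem Mspec_map {K E : Type*} [Field K] [CommRing E] {ι : K →+* E}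
    {dK : K → K} (hdK : IsDeriv dK) {dE : E → E}
    (hdE : IsDeriv dE) (hcomp : ∀ a : K, dE (ι a) = ι (dK a)) {lam : E} (hlam : dE lam = 0)
    (mu : E) {l : ℕ} (A0 A1 : Matrix (Fin l) (Fin l) K) (n : ℕ)
    (Bc : ℕ → Matrix (Fin l) (Fin l) K) :
    (Mspec dK n A0 A1 Bc).map (evalLM ι lam mu) = ME ι dE lam A0 A1 n Bc - mu • 1 := by
  have h2 : ((X : K[X][X]) • (1 : Matrix (Fin l) (Fin l) K[X][X])).map (evalLM ι lam mu) =
      mu • 1 := by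
    ext i j
    by_cases hij : i = j <;> simp [Matrix.one_apply, hij, evalLM]
  have h3 : ∀ M : Matrix (Fin l) (Fin l) K,
      (M.map (C.comp C : K →+* K[X][X])).map (evalLM ι lam mu) = M.map ι := by
    intro M; ext i j; simp [evalLM]
  have h4 : ∀ M : Matrix (Fin l) (Fin l) K[X],
      (M.map (C : K[X] →+* K[X][X])).map (evalLM ι lam mu) = M.map (eval₂RingHom ι lam) := by
    intro M; ext i j; simp [evalLM]
  rw [Mspec, Matrix.map_sub _ (map_sub _), h2, ME]
  congr 1
  rw [← RingHom.mapMatrix_apply, map_sum]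
  refine Finset.sum_congr rfl fun j _ => ?_
  rw [RingHom.mapMatrix_apply, Matrix.map_mul, h3, h4, pMat_map hdK hdE hcomp hlam]

theorem htr_of {K E : Type*} [Field K] [CommRing E] {ι : K →+* E} {lam mu : E}
    (halg : Function.Injective (evalLM ι lam mu)) (p : K[X]) (hp : eval₂ ι lam p = 0) :
    p = 0 := by
  have : (C p : K[X][X]) = 0 := halg (by simpa [evalLM] using hp)
  simpa using this

/-- Corollary 5.6: (1) if `B = R(L)` then `M(L-λ,B-μ) + μ = R(λ)·1`,
`f(λ,μ) = (R(λ) - μ)^ℓ` and `BC = (μ - R(λ))`; (2) if `f = (μ - R(λ))^ℓ` up to a unit and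
`f ∈ BC`, then `BC = ((μ - R(λ))^r)` for the minimal such `r`, `1 ≤ r ≤ ℓ`, and `r = 1`
forces `B = R(L)`. -/
theorem statement14 {K E C₀ : Type*} [Field K] [Field E] [Field C₀] [CharZero K]
    [IsAlgClosed C₀]
    (dK : K → K) (hdK : IsDeriv dK) (dE : E → E) (hdE : IsDeriv dE)
    (ι : K →+* E) (hcomp : ∀ a : K, dE (ι a) = ι (dK a))
    (jC : C₀ →+* K) (hjc : ∀ c, dK (jC c) = 0) (hjsur : ∀ a : K, dK a = 0 → ∃ c, jC c = a)
    (lam mu : E) (hlam : dE lam = 0) (hmu : dE mu = 0)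
    (halg : Function.Injective (evalLM ι lam mu))
    {l : ℕ} (hl : 1 ≤ l)
    (A0 A1 : Matrix (Fin l) (Fin l) K) (hA1 : IsUnit A1.det)
    (n : ℕ) (hn : 1 ≤ n) (Bc : ℕ → Matrix (Fin l) (Fin l) K)
    (hcomm : ∀ ψ : Fin l → E,
      opP ι dE A0 A1 (opQ ι dE n Bc ψ) = opQ ι dE n Bc (opP ι dE A0 A1 ψ))
    (Ψ : Matrix (Fin l) (Fin l) E) (hΨu : IsUnit Ψ.det)
    (hΨ : dMat dE Ψ = NlamE ι lam A0 A1 * Ψ) :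
    (∀ R : Polynomial C₀,
      (∀ ψ : Fin l → E, opQ ι dE n Bc ψ
          = ∑ k ∈ Finset.range (R.natDegree + 1),
              ι (jC (R.coeff k)) • (opP ι dE A0 A1)^[k] ψ) →
      ((Mspec dK n A0 A1 Bc).map (evalLM ι lam mu) + mu • 1
          = Polynomial.eval₂ (ι.comp jC) lam R • (1 : Matrix (Fin l) (Fin l) E))
      ∧ fSpec dK n A0 A1 Bc = (Polynomial.C (R.map jC) - Polynomial.X) ^ l
      ∧ (∀ g : Polynomial (Polynomial C₀),
          (∀ ψ, applyPoly (ι.comp jC) (opP ι dE A0 A1) (opQ ι dE n Bc) g ψ = 0)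
            ↔ (Polynomial.X - Polynomial.C R) ∣ g))
    ∧ (∀ (R : Polynomial C₀) (c : C₀) (fC : Polynomial (Polynomial C₀)),
        c ≠ 0 →
        fC = Polynomial.C (Polynomial.C c) * (Polynomial.X - Polynomial.C R) ^ l →
        fC.map (Polynomial.mapRingHom jC) = fSpec dK n A0 A1 Bc →
        (∀ ψ, applyPoly (ι.comp jC) (opP ι dE A0 A1) (opQ ι dE n Bc) fC ψ = 0) →
        ∃ r : ℕ, 1 ≤ r ∧ r ≤ l
          ∧ (∀ ψ, applyPoly (ι.comp jC) (opP ι dE A0 A1) (opQ ι dE n Bc)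
              ((Polynomial.X - Polynomial.C R) ^ r) ψ = 0)
          ∧ (∀ r' : ℕ, (∀ ψ, applyPoly (ι.comp jC) (opP ι dE A0 A1) (opQ ι dE n Bc)
              ((Polynomial.X - Polynomial.C R) ^ r') ψ = 0) → r ≤ r')
          ∧ (∀ g : Polynomial (Polynomial C₀),
              (∀ ψ, applyPoly (ι.comp jC) (opP ι dE A0 A1) (opQ ι dE n Bc) g ψ = 0)
                ↔ (Polynomial.X - Polynomial.C R) ^ r ∣ g)
          ∧ (r = 1 → ∀ ψ : Fin l → E, opQ ι dE n Bc ψ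
              = ∑ k ∈ Finset.range (R.natDegree + 1),
                  ι (jC (R.coeff k)) • (opP ι dE A0 A1)^[k] ψ)) := by
  have htr := htr_of halg
  have hic : ∀ c, dE ((ι.comp jC) c) = 0 := fun c => by
    rw [RingHom.comp_apply, hcomp, hjc, map_zero]
  have hL : ∀ c, Commute (scE E l ((ι.comp jC) c)) (Lh ι hdE A0 A1) :=
    fun c => scE_Lh ι hdE A0 A1 (hic c)
  have hB : ∀ c, Commute (scE E l ((ι.comp jC) c)) (Bh ι hdE n Bc) :=
    fun c => scE_Bh ι hdE n Bc (hic c)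
  have hLB : Commute (Lh ι hdE A0 A1) (Bh ι hdE n Bc) := by
    ext1 v
    rw [End_mul_apply, End_mul_apply, Lh_coe, Bh_coe]
    exact hcomm v
  have hv : ∀ k, Dh hdE l (fun i => Ψ i k) = NlamE ι lam A0 A1 *ᵥ (fun i => Ψ i k) := by
    intro k
    ext i
    exact congrFun (congrFun hΨ i) k
  have heig : ∀ j k, (Lh ι hdE A0 A1)^[j] (fun i => Ψ i k) = lam ^ j • (fun i => Ψ i k) :=
    fun j k => Lpow_eig _ _ lam (scE_Lh ι hdE A0 A1 hlam) (Lh_eig ι hdE lam A0 A1 hA1 _ (hv k)) j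
  set ρ₁ := rho1 (ι.comp jC) _ hL with hρ₁
  set ρ := rho (ι.comp jC) _ hL _ hB hLB with hρ
  have hρC : ∀ p, ρ (C p) = ρ₁ p := rho_C _ _ hL _ hB hLB
  have hρX : ρ X = Bh ι hdE n Bc := rho_X _ _ hL _ hB hLB
  have hap : ∀ g : C₀[X][X],
      (∀ ψ, applyPoly (ι.comp jC) (opP ι dE A0 A1) (opQ ι dE n Bc) g ψ = 0) ↔ ρ g = 0 := by
    intro g
    rw [← Lh_coe ι hdE, ← Bh_coe ι hdE]
    constructor
    · intro h
      ext1 v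
      rw [hρ, rho_apply]
      exact h v
    · intro h v
      rw [← rho_apply _ _ hL _ hB hLB, ← hρ, h]
      rfl
  have hRB : ∀ R : C₀[X], (∀ ψ : Fin l → E, opQ ι dE n Bc ψ
          = ∑ k ∈ Finset.range (R.natDegree + 1),
              ι (jC (R.coeff k)) • (opP ι dE A0 A1)^[k] ψ) ↔ ρ (X - C R) = 0 := by
    intro R
    rw [map_sub, hρC, hρX, sub_eq_zero]
    constructor
    · intro h
      ext1 v
      rw [hρ₁, rho1_apply, Bh_coe, Lh_coe]
      exact h v
    · intro h v
      rw [← Bh_coe ι hdE, h, hρ₁, rho1_apply, Lh_coe]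
      rfl
  -- cancellation of `e(L)`
  have hcancel : ∀ (e : C₀[X]) (g : C₀[X][X]), e ≠ 0 → ρ (g * C e) = 0 → ρ g = 0 := by
    intro e g he h
    have hmem := rho_mem ι hdE hcomp A0 A1 hA1 n Bc jC hL hB hLB g
    rw [← hρ] at hmem
    refine Phi_inj ι _ lam htr Ψ hΨu heig _ hmem fun k => ?_
    have hne : eval₂ (ι.comp jC) lam e ≠ 0 := by
      intro h0
      rw [← eval₂_map] at h0
      exact he ((Polynomial.map_eq_zero jC).1 (htr _ h0))
    have hce := dE_eval_const hdE hcomp hlam jC hjc e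
    have h1 : ρ (g * C e) (fun i => Ψ i k) = 0 := by rw [h]; rfl
    rw [map_mul, hρC, End_mul_apply, hρ₁, rho1_eig _ _ hL e _ lam (fun j => heig j k)] at h1
    obtain ⟨S, hS⟩ := hmem
    have hcom : Commute (scE E l (eval₂ (ι.comp jC) lam e)) (ρ g) := by
      rw [← hS]
      clear hS
      induction S using Polynomial.induction_on' with
      | add p q hp hq => rw [map_add]; exact hp.add_right hq
      | monomial m M =>
        rw [Phi_monomial]
        exact (scE_matE _ _).mul_right ((scE_Lh ι hdE A0 A1 hce).pow_right _)
    rw [← scE_apply, ← End_mul_apply, ← hcom.eq, End_mul_apply, scE_apply] at h1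
    exact (smul_eq_zero.1 h1).resolve_left hne
  have hone : (1 : AddMonoid.End (Fin l → E)) ≠ 0 := by
    intro h
    have h1 : (1 : AddMonoid.End (Fin l → E)) (fun _ => 1) = 0 := by rw [h]; rfl
    have h2 := congrFun h1 ⟨0, hl⟩
    exact one_ne_zero h2
  have hdecomp : ∀ (R : C₀[X]) (g : C₀[X][X]), ∃ q, g = C (g.eval R) + (X - C R) * q := by
    intro R g
    have h : (X - C R) ∣ g - C (g.eval R) := by
      rw [dvd_iff_isRoot]; simp
    obtain ⟨q, hq⟩ := h
    exact ⟨q, by rw [← hq]; ring⟩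
  refine ⟨?_, ?_⟩
  · intro R hR
    have hR' := (hRB R).1 hR
    have hBR : Bh ι hdE n Bc = ρ₁ R := by
      rw [map_sub, hρC, hρX, sub_eq_zero] at hR'
      exact hR'
    have hM : ME ι dE lam A0 A1 n Bc =
        eval₂ (ι.comp jC) lam R • (1 : Matrix (Fin l) (Fin l) E) := by
      rw [← sub_eq_zero]
      refine mat_eq_zero Ψ _ hΨu fun k => ?_
      rw [Matrix.sub_mulVec, ← Bh_eig ι hdE lam A0 A1 n Bc _ (hv k), hBR, hρ₁,
        rho1_eig _ _ hL R _ lam (fun j => heig j k), Matrix.smul_mulVec, Matrix.one_mulVec,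
        sub_self]
    have hMs := Mspec_map hdK hdE hcomp hlam mu A0 A1 n Bc
    refine ⟨?_, ?_, ?_⟩
    · rw [hMs, sub_add_cancel, hM]
    · apply halg
      rw [fSpec, RingHom.map_det, RingHom.mapMatrix_apply, hMs, hM, ← sub_smul, Matrix.det_smul,
        Matrix.det_one, mul_one, Fintype.card_fin, map_pow]
      simp [evalLM, eval₂_map]
    · intro g
      rw [hap]
      constructor
      · intro hg
        obtain ⟨q, hq⟩ := hdecomp R g
        rw [dvd_iff_isRoot, IsRoot.def]
        by_contra hne
        rw [hq, map_add, map_mul, hR', zero_mul, add_zero] at hg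
        have := hcancel _ 1 hne (by rw [one_mul, hg])
        rw [map_one] at this
        exact hone this
      · rintro ⟨q, rfl⟩
        rw [map_mul, hR', zero_mul]
  · intro R c fC hc hfC _ hf
    rw [hap, hfC, mul_comm] at hf
    have hl' : ρ ((X - C R) ^ l) = 0 := hcancel (C c) _ (by simpa using hc) hf
    classical
    have hex : ∃ r, ρ ((X - C R) ^ r) = 0 := ⟨l, hl'⟩
    have hr1 : 1 ≤ Nat.find hex := by
      rw [Nat.one_le_iff_ne_zero]
      intro h0
      have := Nat.find_spec hex
      rw [h0, pow_zero, map_one] at this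
      exact hone this
    have hmin : ∀ r', ρ ((X - C R) ^ r') = 0 → Nat.find hex ≤ r' := fun r' h => Nat.find_min' hex h
    have hspec := Nat.find_spec hex
    generalize Nat.find hex = r at hr1 hmin hspec
    refine ⟨r, hr1, hmin _ hl', (hap _).2 hspec, fun r' h => hmin _ ((hap _).1 h), ?_, ?_⟩
    · intro g
      rw [hap]
      constructor
      · intro hg
        have key : ∀ s, s ≤ r → (X - C R) ^ s ∣ g := by
          intro s
          induction s with
          | zero => intro _; simp
          | succ s ih =>
            intro hs
            obtain ⟨h, rfl⟩ := ih (by omega)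
            obtain ⟨q, hq⟩ := hdecomp R h
            by_cases he : h.eval R = 0
            · rw [he, map_zero, zero_add] at hq
              exact ⟨q, by rw [hq, pow_succ]; ring⟩
            · exfalso
              obtain ⟨t, rfl⟩ : ∃ t, r = s + 1 + t := ⟨r - (s + 1), by omega⟩
              have h1 : ρ ((X - C R) ^ (s + t) * C (h.eval R)) = 0 := by
                have e : (X - C R) ^ (s + t) * C (h.eval R) =
                    (X - C R) ^ t * ((X - C R) ^ s * h) - (X - C R) ^ (s + 1 + t) * q := by
                  conv_rhs => rw [hq]
                  ring
                rw [e, map_sub, map_mul, hg, map_mul, hspec, mul_zero, zero_mul, sub_zero]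
              have := hmin _ (hcancel _ _ he h1)
              omega
        exact key r le_rfl
      · rintro ⟨q, rfl⟩
        rw [map_mul, hspec, zero_mul]
    · rintro rfl
      rw [hRB]
      simpa using hspec
end

section
/- (Theorem 6.1.) Assume the hypotheses: E is a differential field extension of K with differential constants λ, μ algebraically independent over K, a fundamental matrix Ψ for L − λ exists in M_ℓ(E), and L̂ ∘ B̂ = B̂ ∘ L̂ on E^ℓ. Suppose f(λ,μ) = det M(L−λ, B−μ) factors as f = h^σ with h irreducible in C[λ,μ], and that f ∈ BC. Then BC = (h^r), where r is the minimal positive integer with h^r ∈ BC (so 1 ≤ r ≤ σ); consequently the image algebra C[L̂,B̂] = ρ(C[λ,μ]) is isomorphic as a C-algebra to C[λ,μ]/(h^r). In particular, if σ = 1 (f irreducible), then BC = (f) and C[L̂,B̂] is an integral domain. -/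
open Matrix Polynomial Finset

lemma aux_alg {R : Type*} [CommRing R] [IsDomain R] [UniqueFactorizationMonoid R]
    (I : Ideal R[X]) (ht : ∀ (c : R) (g : R[X]), c ≠ 0 → Polynomial.C c * g ∈ I → g ∈ I)
    (h1 : (1 : R[X]) ∉ I) (h : R[X]) (hirr : Irreducible h) (σ : ℕ) (hσ : h ^ σ ∈ I) :
    ∃ r : ℕ, 1 ≤ r ∧ r ≤ σ ∧ h ^ r ∈ I ∧ (∀ r', h ^ r' ∈ I → r ≤ r') ∧
      ∀ g, g ∈ I ↔ h ^ r ∣ g := by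
  classical
  letI : NormalizedGCDMonoid R := Classical.choice inferInstance
  have hex : ∃ r, h ^ r ∈ I := ⟨σ, hσ⟩
  set r := Nat.find hex with hr
  have hrI : h ^ r ∈ I := Nat.find_spec hex
  have hmin : ∀ r', h ^ r' ∈ I → r ≤ r' := fun r' h' => Nat.find_min' hex h'
  refine ⟨r, ?_, hmin σ hσ, hrI, hmin, ?_⟩
  · rw [Nat.one_le_iff_ne_zero]
    intro h0
    rw [h0, pow_zero] at hrI
    exact h1 hrI
  have hdeg : h.natDegree ≠ 0 := by
    intro h0
    obtain ⟨c, hc⟩ := Polynomial.natDegree_eq_zero.1 h0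
    have hc0 : c ≠ 0 := by
      rintro rfl
      exact hirr.ne_zero (by rw [← hc, map_zero])
    apply h1
    apply ht (c ^ r) 1 (pow_ne_zero _ hc0)
    rw [mul_one, map_pow, hc]
    exact hrI
  have hprim : h.IsPrimitive := hirr.isPrimitive hdeg
  intro g
  refine ⟨fun hg => ?_, fun hd => Ideal.mem_of_dvd I hd hrI⟩
  by_cases hg0 : g = 0
  · rw [hg0]; exact dvd_zero _
  have hfin : FiniteMultiplicity h g := FiniteMultiplicity.of_not_isUnit hirr.not_isUnit hg0
  obtain ⟨q, hq, hnd⟩ := hfin.exists_eq_pow_mul_and_not_dvd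
  set s := multiplicity h g
  by_cases hs : r ≤ s
  · rw [hq]; exact (pow_dvd_pow h hs).mul_right q
  exfalso
  apply hs
  apply hmin
  -- Bezout
  let F := FractionRing R
  have hirrF : Irreducible (h.map (algebraMap R F)) :=
    (hprim.irreducible_iff_irreducible_map_fraction_map (K := F)).1 hirr
  have hq0 : q ≠ 0 := by rintro rfl; exact hnd (dvd_zero _)
  have hndF : ¬ h.map (algebraMap R F) ∣ q.map (algebraMap R F) := by
    intro hd
    exact hnd (Polynomial.IsPrimitive.dvd_of_fraction_map_dvd_fraction_map (K := F) hprim hd)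
  have hcop : IsCoprime ((h.map (algebraMap R F)) ^ r) (q.map (algebraMap R F)) :=
    ((hirrF.coprime_iff_not_dvd).2 hndF).pow_left
  obtain ⟨a, b, hab⟩ := hcop
  obtain ⟨u, hu⟩ := IsLocalization.integerNormalization_map_to_map (nonZeroDivisors R) a
  obtain ⟨v, hv⟩ := IsLocalization.integerNormalization_map_to_map (nonZeroDivisors R) b
  set a' := IsLocalization.integerNormalization (nonZeroDivisors R) a
  set b' := IsLocalization.integerNormalization (nonZeroDivisors R) b
  have hbez : Polynomial.C (v : R) * a' * h ^ r + Polynomial.C (u : R) * b' * q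
      = Polynomial.C ((u : R) * v) := by
    apply Polynomial.map_injective (algebraMap R F) (IsFractionRing.injective R F)
    simp only [Polynomial.map_add, Polynomial.map_mul, Polynomial.map_pow, Polynomial.map_C, hu, hv,
      Algebra.smul_def, Polynomial.algebraMap_apply, map_mul]
    linear_combination (Polynomial.C (algebraMap R F u) * Polynomial.C (algebraMap R F v)) * hab
  apply ht ((u : R) * v) (h ^ s)
    (mul_ne_zero (nonZeroDivisors.coe_ne_zero u) (nonZeroDivisors.coe_ne_zero v))
  rw [← hbez]
  have : (Polynomial.C (v : R) * a' * h ^ r + Polynomial.C (u : R) * b' * q) * h ^ s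
    = (Polynomial.C (v : R) * a' * h ^ s) * h ^ r + (Polynomial.C (u : R) * b') * g := by
    conv_rhs => rw [hq]
    ring
  rw [this]
  exact I.add_mem (I.mul_mem_left _ hrI) (I.mul_mem_left _ hg)

/-- left multipliers of the range -/
def multSub {M R : Type*} [Ring M] [Ring R] (f : M →+* R) (L : R) : Subring R where
  carrier := {y | ∀ P : M[X], ∃ Q : M[X], y * P.eval₂ f L = Q.eval₂ f L}
  mul_mem' := by
    intro a b ha hb P
    obtain ⟨Q, hQ⟩ := hb P
    obtain ⟨Q', hQ'⟩ := ha Q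
    exact ⟨Q', by rw [mul_assoc, hQ, hQ']⟩
  one_mem' := fun P => ⟨P, by simp⟩
  add_mem' := by
    intro a b ha hb P
    obtain ⟨Q, hQ⟩ := hb P
    obtain ⟨Q', hQ'⟩ := ha P
    exact ⟨Q' + Q, by rw [add_mul, hQ, hQ', Polynomial.eval₂_add]⟩
  zero_mem' := fun P => ⟨0, by simp⟩
  neg_mem' := by
    intro a ha P
    obtain ⟨Q', hQ'⟩ := ha P
    refine ⟨-Q', ?_⟩
    have := Polynomial.eval₂_add f L (p := -Q') (q := Q')
    rw [neg_add_cancel, Polynomial.eval₂_zero] at this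
    rw [neg_mul, hQ', eq_neg_of_add_eq_zero_left this.symm]

lemma f_mem_multSub {M R : Type*} [Ring M] [Ring R] (f : M →+* R) (L : R) (G : M) :
    f G ∈ multSub f L := by
  intro P
  induction P using Polynomial.induction_on' with
  | add p q hp hq =>
    obtain ⟨Q, hQ⟩ := hp
    obtain ⟨Q', hQ'⟩ := hq
    exact ⟨Q + Q', by rw [Polynomial.eval₂_add, mul_add, hQ, hQ', Polynomial.eval₂_add]⟩
  | monomial n a =>
    exact ⟨Polynomial.monomial n (G * a), by simp [Polynomial.eval₂_monomial, mul_assoc]⟩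

lemma D_mem_multSub {M R : Type*} [Ring M] [Ring R] (f : M →+* R) (L D : R) (δ : M → M)
    (hD : ∀ G, D * f G = f (δ G) + f G * D) (A0 A1 A1i : M) (hA : A1i * A1 = 1)
    (hL : L = f A0 + f A1 * D) : D ∈ multSub f L := by
  have hD' : D = f A1i * L - f (A1i * A0) := by
    rw [hL, mul_add, ← mul_assoc, ← map_mul, ← map_mul, hA]; simp
  intro P
  induction P using Polynomial.induction_on' with
  | add p q hp hq =>
    obtain ⟨Q, hQ⟩ := hp
    obtain ⟨Q', hQ'⟩ := hq
    exact ⟨Q + Q', by rw [Polynomial.eval₂_add, mul_add, hQ, hQ', Polynomial.eval₂_add]⟩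
  | monomial n a =>
    refine ⟨Polynomial.monomial n (δ a) + Polynomial.monomial (n+1) (a * A1i)
      + Polynomial.monomial n (-(a * (A1i * A0))), ?_⟩
    simp only [Polynomial.eval₂_add, Polynomial.eval₂_monomial]
    rw [← mul_assoc, hD, add_mul, mul_assoc (f a), hD', pow_succ']
    simp only [map_mul, map_neg]
    noncomm_ring

/-- the C₀-linear action of matrices -/
def matAct {K E : Type*} (C₀ : Type*) [Field K] [Field E] [Field C₀] [Algebra C₀ E] (ι : K →+* E)
    (l : ℕ) : Matrix (Fin l) (Fin l) K →+* Module.End C₀ (Fin l → E) where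
  toFun G := (Matrix.mulVecLin (G.map ι)).restrictScalars C₀
  map_one' := by ext; simp
  map_mul' := by
    intro a b
    refine LinearMap.ext fun v => ?_
    simp [Matrix.map_mul]
  map_zero' := by refine LinearMap.ext fun v => ?_; simp
  map_add' := by
    intro a b
    refine LinearMap.ext fun v => ?_
    simp [Matrix.map_add, Matrix.add_mulVec]

lemma matAct_apply {K E : Type*} (C₀ : Type*) [Field K] [Field E] [Field C₀] [Algebra C₀ E]
    (ι : K →+* E) (l : ℕ) (G : Matrix (Fin l) (Fin l) K) (v : Fin l → E) :
    matAct C₀ ι l G v = (G.map ι).mulVec v := rfl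

lemma eval_eigen {C₀ E : Type*} [Field C₀] [Field E] [Algebra C₀ E] {l : ℕ}
    (L : Module.End C₀ (Fin l → E)) (lam : E) (hL : ∀ v, L (lam • v) = lam • L v)
    (v : Fin l → E) (hv : L v = lam • v) (k : ℕ) : (L ^ k) v = lam ^ k • v := by
  induction k with
  | zero => simp
  | succ k ih =>
    have h2 : ∀ k : ℕ, L (lam ^ k • v) = lam ^ k • L v := by
      intro k
      induction k with
      | zero => simp
      | succ k ih => rw [pow_succ', mul_smul, hL, ih, mul_smul]
    rw [pow_succ', Module.End.mul_apply, ih, h2, hv, smul_smul, pow_succ]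

lemma range_inj {K E C₀ : Type*} [Field K] [Field E] [Field C₀] [Algebra C₀ E] (ι : K →+* E)
    {l : ℕ} (lam mu : E) (halg : Function.Injective (evalLM ι lam mu))
    (L : Module.End C₀ (Fin l → E)) (hL : ∀ v, L (lam • v) = lam • L v)
    (Ψ : Matrix (Fin l) (Fin l) E) (hΨu : IsUnit Ψ.det)
    (hΨ : ∀ j, L (Ψ.col j) = lam • Ψ.col j)
    (P : (Matrix (Fin l) (Fin l) K)[X])
    (hP : ∀ j, P.eval₂ (matAct C₀ ι l) L (Ψ.col j) = 0) : P = 0 := by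
  have key : ∀ j, (∑ k ∈ P.support, lam ^ k • (P.coeff k).map ι).mulVec (Ψ.col j) = 0 := by
    intro j
    rw [← hP j, Polynomial.eval₂_eq_sum, Polynomial.sum, LinearMap.sum_apply, Matrix.sum_mulVec]
    refine Finset.sum_congr rfl fun k _ => ?_
    rw [Module.End.mul_apply, eval_eigen L lam hL _ (hΨ j), matAct_apply, Matrix.mulVec_smul,
      Matrix.smul_mulVec]
  have hQ : (∑ k ∈ P.support, lam ^ k • (P.coeff k).map ι) * Ψ = 0 := by
    ext i j
    exact congrFun (key j) i
  have hQ0 : (∑ k ∈ P.support, lam ^ k • (P.coeff k).map ι) = 0 := by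
    have := congrArg (· * Ψ⁻¹) hQ
    simpa [Matrix.mul_assoc, Matrix.mul_nonsing_inv _ hΨu] using this
  have hp : ∀ i m, (∑ k ∈ P.support, Polynomial.monomial k (P.coeff k i m)) = 0 := by
    intro i m
    have h2 := congrFun (congrFun hQ0 i) m
    have h3 : evalLM ι lam mu (Polynomial.C (∑ k ∈ P.support,
        Polynomial.monomial k (P.coeff k i m))) = evalLM ι lam mu 0 := by
      rw [map_zero, ← Matrix.zero_apply (α := E) i m, ← h2, Matrix.sum_apply]
      simp [evalLM, Polynomial.eval₂_finset_sum, Polynomial.eval₂_monomial, mul_comm]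
    exact Polynomial.C_eq_zero.1 (halg h3)
  ext k i m
  have := congrArg (fun p => Polynomial.coeff p k) (hp i m)
  simp only [Polynomial.finsetSum_coeff, Polynomial.coeff_monomial, Polynomial.coeff_zero] at this
  rw [Finset.sum_ite_eq'] at this
  by_cases hk : k ∈ P.support
  · simpa [hk] using this
  · simp [Polynomial.notMem_support_iff.1 hk]

/-- Theorem 6.1: if the spectral curve is irreducible, `f = h^σ` with `h`
irreducible, and `f ∈ BC`, then `BC = (h^r)` for the minimal `r` with `h^r ∈ BC`
(`1 ≤ r ≤ σ`), so `C[L,B] ≅ C[λ,μ]/(h^r)`; if moreover `f` itself is irreducible (`σ = 1`)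
then `BC = (f)` is prime, i.e. `C[L,B]` is an integral domain. -/
theorem statement15 {K E C₀ : Type*} [Field K] [Field E] [Field C₀] [CharZero K]
    [IsAlgClosed C₀]
    (dK : K → K) (hdK : IsDeriv dK) (dE : E → E) (hdE : IsDeriv dE)
    (ι : K →+* E) (hcomp : ∀ a : K, dE (ι a) = ι (dK a))
    (jC : C₀ →+* K) (hjc : ∀ c, dK (jC c) = 0) (hjsur : ∀ a : K, dK a = 0 → ∃ c, jC c = a)
    (lam mu : E) (hlam : dE lam = 0) (hmu : dE mu = 0)
    (halg : Function.Injective (evalLM ι lam mu))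
    {l : ℕ} (hl : 1 ≤ l)
    (A0 A1 : Matrix (Fin l) (Fin l) K) (hA1 : IsUnit A1.det)
    (n : ℕ) (hn : 1 ≤ n) (Bc : ℕ → Matrix (Fin l) (Fin l) K)
    (hcomm : ∀ ψ : Fin l → E,
      opP ι dE A0 A1 (opQ ι dE n Bc ψ) = opQ ι dE n Bc (opP ι dE A0 A1 ψ))
    (Ψ : Matrix (Fin l) (Fin l) E) (hΨu : IsUnit Ψ.det)
    (hΨ : dMat dE Ψ = NlamE ι lam A0 A1 * Ψ)
    (fC : Polynomial (Polynomial C₀))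
    (hfC : fC.map (Polynomial.mapRingHom jC) = fSpec dK n A0 A1 Bc)
    (h : Polynomial (Polynomial C₀)) (σ : ℕ) (hσ : 1 ≤ σ)
    (hirr : Irreducible h) (hfact : fC = h ^ σ)
    (hfBC : ∀ ψ, applyPoly (ι.comp jC) (opP ι dE A0 A1) (opQ ι dE n Bc) fC ψ = 0) :
    ∃ r : ℕ, 1 ≤ r ∧ r ≤ σ
      ∧ (∀ ψ, applyPoly (ι.comp jC) (opP ι dE A0 A1) (opQ ι dE n Bc) (h ^ r) ψ = 0)
      ∧ (∀ r' : ℕ,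
          (∀ ψ, applyPoly (ι.comp jC) (opP ι dE A0 A1) (opQ ι dE n Bc) (h ^ r') ψ = 0) →
          r ≤ r')
      ∧ (∀ g : Polynomial (Polynomial C₀),
          (∀ ψ, applyPoly (ι.comp jC) (opP ι dE A0 A1) (opQ ι dE n Bc) g ψ = 0)
            ↔ h ^ r ∣ g)
      ∧ (σ = 1 →
          (∀ g : Polynomial (Polynomial C₀),
            (∀ ψ, applyPoly (ι.comp jC) (opP ι dE A0 A1) (opQ ι dE n Bc) g ψ = 0)
              ↔ fC ∣ g)
          ∧ (Ideal.span {fC} : Ideal (Polynomial (Polynomial C₀))).IsPrime) := by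
  classical
  letI : Algebra C₀ E := (ι.comp jC).toAlgebra
  have hsm : ∀ (c : C₀) (v : Fin l → E), c • v = (ι (jC c)) • v := by
    intro c v
    ext i
    simp [Algebra.smul_def, RingHom.algebraMap_toAlgebra]
  obtain ⟨hdadd, hdmul⟩ := hdE
  have hd0 : dE 0 = 0 := by simpa using hdadd 0 0
  have hconst : ∀ (e : E), dE e = 0 → ∀ v : Fin l → E, dVec dE (e • v) = e • dVec dE v := by
    intro e he v
    ext i
    simp [dVec, hdmul, he]
  let D : Module.End C₀ (Fin l → E) :=
    { toFun := dVec dE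
      map_add' := by intro a b; ext i; simp [dVec, hdadd]
      map_smul' := by
        intro c v
        rw [hsm, RingHom.id_apply, hsm]
        apply hconst
        rw [hcomp, hjc, map_zero] }
  have hDap : ∀ v, D v = dVec dE v := fun v => rfl
  let f := matAct C₀ ι l
  let L : Module.End C₀ (Fin l → E) := f A0 + f A1 * D
  let B : Module.End C₀ (Fin l → E) := ∑ j ∈ Finset.range (n + 1), f (Bc j) * D ^ j
  have hLap : ∀ v, L v = opP ι dE A0 A1 v := fun v => rfl
  have hDp : ∀ (j : ℕ) v, (D ^ j) v = (dVec dE)^[j] v := by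
    intro j v
    rw [Module.End.pow_apply]
    rfl
  have hBap : ∀ v, B v = opQ ι dE n Bc v := by
    intro v
    simp only [B, opQ, LinearMap.sum_apply, Module.End.mul_apply, hDp]
    rfl
  have hLB : L * B = B * L := by
    refine LinearMap.ext fun v => ?_
    simp only [Module.End.mul_apply, hLap, hBap, hcomm]
  have hcommute : ∀ p : Polynomial C₀, Commute (Polynomial.aeval L p) B := by
    intro p
    have : Polynomial.aeval L p ∈ Subalgebra.centralizer C₀ {B} := by
      have h2 : Algebra.adjoin C₀ {L} ≤ Subalgebra.centralizer C₀ {B} := by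
        rw [Algebra.adjoin_le_iff]
        rintro _ rfl
        rw [SetLike.mem_coe, Subalgebra.mem_centralizer_iff]
        rintro _ rfl
        exact hLB.symm
      exact h2 (Polynomial.aeval_mem_adjoin_singleton C₀ L)
    rw [Subalgebra.mem_centralizer_iff] at this
    exact (this B rfl).symm
  let ρ : Polynomial (Polynomial C₀) →+* Module.End C₀ (Fin l → E) :=
    Polynomial.eval₂RingHom' (Polynomial.aeval L : Polynomial C₀ →ₐ[C₀] _).toRingHom B hcommute
  have hρ : ∀ g, ρ g = Polynomial.eval₂
      (Polynomial.aeval L : Polynomial C₀ →ₐ[C₀] _).toRingHom B g := fun g => rfl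
  have hρC : ∀ c, ρ (Polynomial.C c) = Polynomial.aeval L c := by
    intro c
    rw [hρ, Polynomial.eval₂_C]
    rfl
  have hap : ∀ g ψ, applyPoly (ι.comp jC) (opP ι dE A0 A1) (opQ ι dE n Bc) g ψ = ρ g ψ := by
    intro g ψ
    rw [hρ, Polynomial.eval₂_eq_sum_range, LinearMap.sum_apply, applyPoly]
    refine Finset.sum_congr rfl fun i _ => ?_
    rw [Module.End.mul_apply]
    change _ = Polynomial.aeval L (g.coeff i) _
    rw [Polynomial.aeval_eq_sum_range, LinearMap.sum_apply]
    refine Finset.sum_congr rfl fun k _ => ?_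
    rw [LinearMap.smul_apply, hsm, Module.End.pow_apply, Module.End.pow_apply,
      ← funext hLap, ← funext hBap]
    rfl
  have hker : ∀ g, (∀ ψ, applyPoly (ι.comp jC) (opP ι dE A0 A1) (opQ ι dE n Bc) g ψ = 0)
      ↔ g ∈ RingHom.ker ρ := by
    intro g
    rw [RingHom.mem_ker]
    constructor
    · intro h2
      exact LinearMap.ext fun ψ => by rw [← hap, h2]; rfl
    · intro h2 ψ
      rw [hap, h2]; rfl
  -- the ring of multipliers
  have hDf : ∀ G, D * f G = f (G.map dK) + f G * D := by
    intro G
    refine LinearMap.ext fun v => ?_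
    ext i
    have hsum : ∀ (s : Finset (Fin l)) (w : Fin l → E), dE (∑ x ∈ s, w x) = ∑ x ∈ s, dE (w x) :=
      fun s w => map_sum (AddMonoidHom.mk' dE hdadd) w s
    simp only [Module.End.mul_apply, LinearMap.add_apply, f, matAct_apply, hDap, dVec,
      Matrix.mulVec, dotProduct, Pi.add_apply, hsum, hdmul, Matrix.map_apply, hcomp,
      Finset.sum_add_distrib]
  have hDm : D ∈ multSub f L :=
    D_mem_multSub f L D (fun G => G.map dK) hDf A0 A1 A1⁻¹ (Matrix.nonsing_inv_mul _ hA1) rfl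
  have hLm : L ∈ multSub f L :=
    add_mem (f_mem_multSub f L _) (mul_mem (f_mem_multSub f L _) hDm)
  have hBm : B ∈ multSub f L :=
    sum_mem fun j _ => mul_mem (f_mem_multSub f L _) (pow_mem hDm j)
  have halgm : ∀ c : C₀, algebraMap C₀ (Module.End C₀ (Fin l → E)) c = f (jC c • 1) := by
    intro c
    refine LinearMap.ext fun v => ?_
    rw [Module.algebraMap_end_apply, hsm]
    ext i
    simp [f, matAct_apply, Matrix.mulVec, dotProduct, Matrix.smul_apply, Matrix.one_apply,
      apply_ite ι]
  have hS : ∀ (S : Subring (Module.End C₀ (Fin l → E))), L ∈ S → B ∈ S →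
      (∀ c, algebraMap C₀ (Module.End C₀ (Fin l → E)) c ∈ S) → ∀ g, ρ g ∈ S := by
    intro S h1 h2 h3 g
    rw [hρ, Polynomial.eval₂_eq_sum_range]
    refine sum_mem fun i _ => mul_mem ?_ (pow_mem h2 i)
    change Polynomial.aeval L (g.coeff i) ∈ S
    rw [Polynomial.aeval_eq_sum_range]
    refine sum_mem fun k _ => ?_
    rw [Algebra.smul_def]
    exact mul_mem (h3 _) (pow_mem h1 k)
  have hrange : ∀ g, ∃ P : Polynomial (Matrix (Fin l) (Fin l) K), ρ g = P.eval₂ f L := by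
    intro g
    obtain ⟨Q, hQ⟩ := hS (multSub f L) hLm hBm
      (fun c => by rw [halgm]; exact f_mem_multSub f L _) g 1
    exact ⟨Q, by rw [← hQ, Polynomial.eval₂_one, mul_one]⟩
  -- commutation with multiplication by lam
  let Λ : Module.End C₀ (Fin l → E) := Algebra.lsmul C₀ C₀ (Fin l → E) lam
  have hΛ : ∀ v, Λ v = lam • v := fun v => rfl
  have hcf : ∀ G, Λ * f G = f G * Λ := by
    intro G
    refine LinearMap.ext fun v => ?_
    simp only [Module.End.mul_apply, hΛ, f, matAct_apply, Matrix.mulVec_smul]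
  have hcD : Λ * D = D * Λ := by
    refine LinearMap.ext fun v => ?_
    simp only [Module.End.mul_apply, hΛ, hDap, hconst lam hlam]
  have hmc : ∀ x, x ∈ Subring.centralizer {Λ} ↔ Λ * x = x * Λ := by
    intro x
    rw [Subring.mem_centralizer_iff]
    simp
  have hLc : L ∈ Subring.centralizer {Λ} :=
    add_mem ((hmc _).2 (hcf _)) (mul_mem ((hmc _).2 (hcf _)) ((hmc _).2 hcD))
  have hBc : B ∈ Subring.centralizer {Λ} :=
    sum_mem fun j _ => mul_mem ((hmc _).2 (hcf _)) (pow_mem ((hmc _).2 hcD) j)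
  have hcρ : ∀ g, ρ g ∈ Subring.centralizer {Λ} :=
    hS _ hLc hBc (fun c => by rw [halgm]; exact (hmc _).2 (hcf _))
  have hLlam : ∀ v, L (lam • v) = lam • L v := fun v =>
    (LinearMap.congr_fun ((hmc _).1 hLc) v).symm
  -- eigenvectors
  have hcol : ∀ j, L (Ψ.col j) = lam • Ψ.col j := by
    intro j
    have h1 : A0.map ι * Ψ + A1.map ι * dMat dE Ψ = lam • Ψ := by
      have h2 : A1.map ι * (A1⁻¹).map ι = 1 := by
        rw [← Matrix.map_mul, Matrix.mul_nonsing_inv _ hA1]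
        simp
      rw [hΨ, NlamE, ← Matrix.mul_assoc, Matrix.mul_neg, ← Matrix.mul_assoc, h2, Matrix.one_mul,
        neg_sub, Matrix.sub_mul, Matrix.smul_mul, Matrix.one_mul]
      abel
    ext i
    exact congrFun (congrFun h1 i) j
  have hzero : ∀ g, (∀ j, ρ g (Ψ.col j) = 0) → ρ g = 0 := by
    intro g hg
    obtain ⟨P, hP⟩ := hrange g
    have := range_inj ι lam mu halg L hLlam Ψ hΨu hcol P (fun j => by rw [← hg j, hP])
    rw [hP, this, Polynomial.eval₂_zero]
  have htor : ∀ (c : Polynomial C₀) (g : Polynomial (Polynomial C₀)), c ≠ 0 →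
      Polynomial.C c * g ∈ RingHom.ker ρ → g ∈ RingHom.ker ρ := by
    intro c g hc hg
    rw [RingHom.mem_ker] at hg ⊢
    apply hzero
    intro j
    have hgL : ρ g * L = L * ρ g := by
      have := congrArg ρ (mul_comm g (Polynomial.C Polynomial.X))
      simpa only [map_mul, hρC, Polynomial.aeval_X] using this
    have heig : L (ρ g (Ψ.col j)) = lam • ρ g (Ψ.col j) := by
      have h1 := LinearMap.congr_fun hgL (Ψ.col j)
      have h2 := LinearMap.congr_fun ((hmc _).1 (hcρ g)) (Ψ.col j)
      simp only [Module.End.mul_apply, hΛ] at h1 h2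
      rw [← h1, hcol, h2]
    have h3 := LinearMap.congr_fun hg (Ψ.col j)
    rw [map_mul, hρC, Module.End.mul_apply, LinearMap.zero_apply] at h3
    have h4 : Polynomial.aeval L c (ρ g (Ψ.col j))
        = (evalLM ι lam mu (Polynomial.C (c.map jC))) • ρ g (Ψ.col j) := by
      rw [Polynomial.aeval_eq_sum_range, LinearMap.sum_apply]
      have : evalLM ι lam mu (Polynomial.C (c.map jC))
          = ∑ k ∈ Finset.range (c.natDegree + 1), ι (jC (c.coeff k)) * lam ^ k := by
        simp only [evalLM, Polynomial.coe_eval₂RingHom, Polynomial.eval₂_C, Polynomial.eval₂_map]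
        rw [Polynomial.eval₂_eq_sum_range]
        rfl
      rw [this, Finset.sum_smul]
      refine Finset.sum_congr rfl fun k _ => ?_
      rw [LinearMap.smul_apply, eval_eigen L lam hLlam _ heig, hsm, smul_smul]
    rw [h4, smul_eq_zero] at h3
    refine h3.resolve_left fun h5 => hc ?_
    rw [← map_zero (evalLM ι lam mu)] at h5
    have h6 := Polynomial.C_eq_zero.1 (halg h5)
    exact (Polynomial.map_eq_zero jC).1 h6
  have hone : (1 : Polynomial (Polynomial C₀)) ∉ RingHom.ker ρ := by
    rw [RingHom.mem_ker, map_one]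
    intro h1
    have h2 := congrFun (LinearMap.congr_fun h1 (fun _ => 1)) ⟨0, hl⟩
    simp at h2
  obtain ⟨r, hr1, hr2, hr3, hr4, hr5⟩ :=
    aux_alg (RingHom.ker ρ) htor hone h hirr σ (by rw [← hfact, ← hker]; exact hfBC)
  refine ⟨r, hr1, hr2, (hker _).2 hr3, fun r' h' => hr4 r' ((hker _).1 h'),
    fun g => (hker g).trans (hr5 g), ?_⟩
  intro hs1
  have hre : r = 1 := by omega
  subst hs1
  rw [pow_one] at hfact
  subst hfact
  refine ⟨fun g => (hker g).trans ?_, ?_⟩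
  · rw [hr5, hre, pow_one]
  · rw [Ideal.span_singleton_prime hirr.ne_zero]
    exact hirr.prime
end

section
/- (Theorem 7.1.) Let ℓ = 2. Assume the hypotheses: E is a differential field extension of K with differential constants λ, μ algebraically independent over K, a fundamental matrix Ψ for L − λ exists in M_2(E), and L̂ ∘ B̂ = B̂ ∘ L̂ on E². Let f(λ,μ) = det M(L−λ, B−μ). If f ∈ BC (i.e., f(L̂,B̂) = 0) and there is no polynomial R ∈ C[λ] with B̂ = R(L̂) on E², then BC = (f). -/
open Matrix Polynomial Finset

section Helpers

variable {K E C₀ : Type*} [Field K] [Field E] [Field C₀] [Algebra C₀ E]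

/-- multiplication by a matrix over `K`, as a ring hom -/
noncomputable def hMul (C₀ : Type*) [Field C₀] [Algebra C₀ E] (ι : K →+* E) :
    Matrix (Fin 2) (Fin 2) K →+* Module.End C₀ (Fin 2 → E) where
  toFun A :=
    { toFun := fun ψ => (A.map ι).mulVec ψ
      map_add' := fun x y => Matrix.mulVec_add _ _ _
      map_smul' := fun c x => Matrix.mulVec_smul _ _ _ }
  map_one' := by
    refine LinearMap.ext fun x => ?_
    simp [Matrix.map_one]
  map_mul' A B := by
    refine LinearMap.ext fun x => ?_
    change ((A * B).map ι).mulVec x = (A.map ι).mulVec ((B.map ι).mulVec x)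
    rw [Matrix.map_mul, Matrix.mulVec_mulVec]
  map_zero' := by
    refine LinearMap.ext fun x => ?_
    simp
  map_add' A B := by
    refine LinearMap.ext fun x => ?_
    simp [Matrix.map_add, Matrix.add_mulVec]

theorem hMul_apply (ι : K →+* E) (A : Matrix (Fin 2) (Fin 2) K) (ψ : Fin 2 → E) :
    hMul C₀ ι A ψ = (A.map ι).mulVec ψ := rfl

/-- derivation as a linear map -/
noncomputable def hD (dE : E → E) (hdE : IsDeriv dE) (hc : ∀ c : C₀, dE (algebraMap C₀ E c) = 0) :
    Module.End C₀ (Fin 2 → E) where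
  toFun := dVec dE
  map_add' x y := by
    funext i
    simp [dVec, hdE.1]
  map_smul' c x := by
    funext i
    simp [dVec, Algebra.smul_def, hdE.2, hc]

theorem dE_sum (dE : E → E) (hdE : IsDeriv dE) (a b c d : E) :
    dE (a * b + c * d) = dE a * b + a * dE b + (dE c * d + c * dE d) := by
  rw [hdE.1, hdE.2, hdE.2]

theorem hD_mul (dK : K → K) (dE : E → E) (hdE : IsDeriv dE)
    (hc : ∀ c : C₀, dE (algebraMap C₀ E c) = 0)
    (ι : K →+* E) (hcomp : ∀ a : K, dE (ι a) = ι (dK a)) (A : Matrix (Fin 2) (Fin 2) K) :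
    hD dE hdE hc * hMul C₀ ι A = hMul C₀ ι A * hD dE hdE hc + hMul C₀ ι (A.map dK) := by
  refine LinearMap.ext fun x => ?_
  funext i
  change dE (((A.map ι).mulVec x) i) = ((A.map ι).mulVec (dVec dE x)) i
    + (((A.map dK).map ι).mulVec x) i
  simp only [dVec, Matrix.mulVec, dotProduct, Fin.sum_univ_two, hdE.1, hdE.2, hcomp,
    Matrix.map_apply]
  ring

theorem rep_D (dK : K → K) (ι : K →+* E) (L D : Module.End C₀ (Fin 2 → E))
    (A0 A1 : Matrix (Fin 2) (Fin 2) K)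
    (hDm : ∀ A, D * hMul C₀ ι A = hMul C₀ ι A * D + hMul C₀ ι (A.map dK))
    (hDL : D = hMul C₀ ι A1⁻¹ * L - hMul C₀ ι (A1⁻¹ * A0))
    (P : (Matrix (Fin 2) (Fin 2) K)[X]) :
    ∃ Q : (Matrix (Fin 2) (Fin 2) K)[X], D * P.eval₂ (hMul C₀ ι) L = Q.eval₂ (hMul C₀ ι) L := by
  induction P using Polynomial.induction_on' with
  | add p q hp hq =>
    obtain ⟨a, ha⟩ := hp
    obtain ⟨b, hb⟩ := hq
    exact ⟨a + b, by rw [eval₂_add, eval₂_add, mul_add, ha, hb]⟩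
  | monomial k A =>
    refine ⟨monomial (k+1) (A * A1⁻¹) + monomial k (A.map dK - A * (A1⁻¹ * A0)), ?_⟩
    rw [eval₂_add, eval₂_monomial, eval₂_monomial, eval₂_monomial, ← mul_assoc, hDm]
    conv_lhs => rw [hDL]
    simp only [map_sub, map_mul, pow_succ', mul_sub, sub_mul, add_mul, mul_assoc]
    abel

theorem rep_mul (ι : K →+* E) (L : Module.End C₀ (Fin 2 → E))
    (A : Matrix (Fin 2) (Fin 2) K) (P : (Matrix (Fin 2) (Fin 2) K)[X]) :
    ∃ Q : (Matrix (Fin 2) (Fin 2) K)[X], hMul C₀ ι A * P.eval₂ (hMul C₀ ι) L = Q.eval₂ (hMul C₀ ι) L := by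
  induction P using Polynomial.induction_on' with
  | add p q hp hq =>
    obtain ⟨a, ha⟩ := hp
    obtain ⟨b, hb⟩ := hq
    exact ⟨a + b, by rw [eval₂_add, eval₂_add, mul_add, ha, hb]⟩
  | monomial k B =>
    refine ⟨monomial k (A * B), ?_⟩
    rw [eval₂_monomial, eval₂_monomial, ← mul_assoc, map_mul]

theorem rep_B (dK : K → K) (ι : K →+* E) (L D : Module.End C₀ (Fin 2 → E))
    (A0 A1 : Matrix (Fin 2) (Fin 2) K)
    (hDm : ∀ A, D * hMul C₀ ι A = hMul C₀ ι A * D + hMul C₀ ι (A.map dK))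
    (hDL : D = hMul C₀ ι A1⁻¹ * L - hMul C₀ ι (A1⁻¹ * A0))
    (n : ℕ) (Bc : ℕ → Matrix (Fin 2) (Fin 2) K) :
    ∃ Q : (Matrix (Fin 2) (Fin 2) K)[X], ∑ j ∈ Finset.range n, hMul C₀ ι (Bc j) * D ^ j = Q.eval₂ (hMul C₀ ι) L := by
  have hp : ∀ j : ℕ, ∃ Q, D ^ j = Polynomial.eval₂ (hMul C₀ ι) L Q := by
    intro j
    induction j with
    | zero => exact ⟨1, by simp⟩
    | succ j ih =>
      obtain ⟨Q, hQ⟩ := ih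
      rw [pow_succ', hQ]
      exact rep_D dK ι L D A0 A1 hDm hDL Q
  induction n with
  | zero => exact ⟨0, by simp⟩
  | succ n ih =>
    obtain ⟨Q, hQ⟩ := ih
    obtain ⟨Q1, hQ1⟩ := hp n
    obtain ⟨Q2, hQ2⟩ := rep_mul ι L (Bc n) Q1
    exact ⟨Q + Q2, by rw [Finset.sum_range_succ, hQ, hQ1, hQ2, eval₂_add]⟩

theorem pow_eig (L : Module.End C₀ (Fin 2 → E)) (lam : E)
    (hL : ∀ φ : Fin 2 → E, L (lam • φ) = lam • L φ)
    (ψ : Fin 2 → E) (hψ : L ψ = lam • ψ) (k : ℕ) : (L ^ k) ψ = lam ^ k • ψ := by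
  induction k with
  | zero => simp
  | succ k ih =>
    rw [pow_succ, Module.End.mul_apply, hψ]
    have : ∀ φ : Fin 2 → E, (L ^ k) (lam • φ) = lam • (L ^ k) φ := by
      intro φ
      clear ih
      induction k with
      | zero => simp
      | succ k ih => rw [pow_succ', Module.End.mul_apply, ih, hL, Module.End.mul_apply]
    rw [this, ih, smul_smul, pow_succ']

theorem ev_rep (ι : K →+* E) (L : Module.End C₀ (Fin 2 → E)) (lam : E)
    (ψ : Fin 2 → E) (hψ : ∀ k : ℕ, (L ^ k) ψ = lam ^ k • ψ)
    (P : (Matrix (Fin 2) (Fin 2) K)[X]) :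
    P.eval₂ (hMul C₀ ι) L ψ
      = ((matPolyEquiv.symm P).map (eval₂RingHom ι lam)).mulVec ψ := by
  induction P using Polynomial.induction_on' with
  | add p q hp hq =>
    rw [eval₂_add, LinearMap.add_apply, hp, hq, map_add, Matrix.map_add _ (by simp),
      Matrix.add_mulVec]
  | monomial k A =>
    rw [eval₂_monomial, Module.End.mul_apply, hψ, hMul_apply, Matrix.mulVec_smul,
      ← Matrix.smul_mulVec]
    congr 1
    ext a b
    have : (matPolyEquiv.symm (monomial k A)) a b = monomial k (A a b) := by
      ext m
      rw [← matPolyEquiv_coeff_apply]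
      simp [coeff_monomial]
      split_ifs <;> simp
    simp [this, mul_comm]

theorem ev_aeval (L : Module.End C₀ (Fin 2 → E)) (lam : E)
    (ψ : Fin 2 → E) (hψ : ∀ k : ℕ, (L ^ k) ψ = lam ^ k • ψ) (r : C₀[X]) :
    aeval L r ψ = aeval lam r • ψ := by
  induction r using Polynomial.induction_on' with
  | add p q hp hq => rw [map_add, map_add, LinearMap.add_apply, hp, hq, add_smul]
  | monomial k c =>
    rw [aeval_monomial, aeval_monomial, Module.End.mul_apply, hψ, Module.algebraMap_end_apply,
      mul_smul, algebraMap_smul]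

theorem const_aeval (dE : E → E) (hdE : IsDeriv dE) (hc : ∀ c : C₀, dE (algebraMap C₀ E c) = 0)
    (lam : E) (hlam : dE lam = 0) (r : C₀[X]) : dE (aeval lam r) = 0 := by
  have hp : ∀ k : ℕ, dE (lam ^ k) = 0 := by
    intro k
    induction k with
    | zero => simpa using hc 1
    | succ k ih => rw [pow_succ, hdE.2, ih, hlam]; simp
  induction r using Polynomial.induction_on' with
  | add p q hp hq => rw [map_add, hdE.1, hp, hq, add_zero]
  | monomial k c => rw [aeval_monomial, hdE.2, hc, hp]; simp

theorem fC_monic [CharZero K] (jC : C₀ →+* K) (dK : K → K)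
    (A0 A1 : Matrix (Fin 2) (Fin 2) K) (n : ℕ) (Bc : ℕ → Matrix (Fin 2) (Fin 2) K)
    (fC : Polynomial (Polynomial C₀))
    (hfC : fC.map (Polynomial.mapRingHom jC) = fSpec dK n A0 A1 Bc) :
    fC.Monic ∧ fC.natDegree = 2 := by
  have hinj : Function.Injective (Polynomial.mapRingHom jC) := Polynomial.map_injective _ jC.injective
  set M : Matrix (Fin 2) (Fin 2) K[X] := ∑ j ∈ Finset.range (n + 1),
      (Bc j).map (Polynomial.C : K →+* Polynomial K) * (pMat (dPoly dK) (Nlam A0 A1) j) with hM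
  have h1 : Mspec dK n A0 A1 Bc = - M.charmatrix := by
    have : M.map (Polynomial.C : K[X] →+* K[X][X]) = ∑ j ∈ Finset.range (n + 1),
      (Bc j).map (Polynomial.C.comp Polynomial.C : K →+* Polynomial (Polynomial K)) *
        (pMat (dPoly dK) (Nlam A0 A1) j).map
          (Polynomial.C : Polynomial K →+* Polynomial (Polynomial K)) := by
      rw [← RingHom.mapMatrix_apply, hM, map_sum]
      refine Finset.sum_congr rfl fun j _ => ?_
      rw [map_mul]
      rfl
    rw [Mspec, ← this, Matrix.charmatrix, neg_sub]
    congr 1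
    rw [Matrix.scalar_apply, Matrix.smul_one_eq_diagonal]
  have h2 : fSpec dK n A0 A1 Bc = M.charpoly := by
    rw [fSpec, h1, Matrix.det_neg, Matrix.charpoly, Fintype.card_fin]
    ring
  rw [h2] at hfC
  constructor
  · apply Polynomial.monic_of_injective hinj
    rw [hfC]
    exact M.charpoly_monic
  · rw [← Polynomial.natDegree_map_eq_of_injective hinj, hfC, M.charpoly_natDegree_eq_dim]
    simp

end Helpers

/-- Theorem 7.1: for `ℓ = 2`, if `f ∈ BC` and `B` is not a polynomial in
`L` with constant coefficients, then `BC = (f)`. -/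
theorem statement17 {K E C₀ : Type*} [Field K] [Field E] [Field C₀] [CharZero K]
    [IsAlgClosed C₀]
    (dK : K → K) (hdK : IsDeriv dK) (dE : E → E) (hdE : IsDeriv dE)
    (ι : K →+* E) (hcomp : ∀ a : K, dE (ι a) = ι (dK a))
    (jC : C₀ →+* K) (hjc : ∀ c, dK (jC c) = 0) (hjsur : ∀ a : K, dK a = 0 → ∃ c, jC c = a)
    (lam mu : E) (hlam : dE lam = 0) (hmu : dE mu = 0)
    (halg : Function.Injective (evalLM ι lam mu))
    (A0 A1 : Matrix (Fin 2) (Fin 2) K) (hA1 : IsUnit A1.det)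
    (n : ℕ) (hn : 1 ≤ n) (Bc : ℕ → Matrix (Fin 2) (Fin 2) K)
    (hcomm : ∀ ψ : Fin 2 → E,
      opP ι dE A0 A1 (opQ ι dE n Bc ψ) = opQ ι dE n Bc (opP ι dE A0 A1 ψ))
    (Ψ : Matrix (Fin 2) (Fin 2) E) (hΨu : IsUnit Ψ.det)
    (hΨ : dMat dE Ψ = NlamE ι lam A0 A1 * Ψ)
    (fC : Polynomial (Polynomial C₀))
    (hfC : fC.map (Polynomial.mapRingHom jC) = fSpec dK n A0 A1 Bc)
    (hfBC : ∀ ψ, applyPoly (ι.comp jC) (opP ι dE A0 A1) (opQ ι dE n Bc) fC ψ = 0)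
    (hnot : ¬∃ R : Polynomial C₀, ∀ ψ : Fin 2 → E,
      opQ ι dE n Bc ψ
        = ∑ k ∈ Finset.range (R.natDegree + 1),
            ι (jC (R.coeff k)) • (opP ι dE A0 A1)^[k] ψ) :
    ∀ g : Polynomial (Polynomial C₀),
      (∀ ψ, applyPoly (ι.comp jC) (opP ι dE A0 A1) (opQ ι dE n Bc) g ψ = 0) ↔ fC ∣ g := by
  classical
  letI : Algebra C₀ E := (ι.comp jC).toAlgebra
  have ham : ∀ c : C₀, algebraMap C₀ E c = ι (jC c) := fun c => rfl
  have hc : ∀ c : C₀, dE (algebraMap C₀ E c) = 0 := by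
    intro c
    rw [ham, hcomp, hjc, map_zero]
  set D : Module.End C₀ (Fin 2 → E) := hD dE hdE hc with hDdef
  have hDa : ∀ ψ, D ψ = dVec dE ψ := fun ψ => rfl
  set L : Module.End C₀ (Fin 2 → E) := hMul C₀ ι A0 + hMul C₀ ι A1 * D with hLdef
  have hLa : ∀ ψ, L ψ = opP ι dE A0 A1 ψ := fun ψ => rfl
  have hDm := fun A => hD_mul (C₀ := C₀) dK dE hdE hc ι hcomp A
  have hinv : A1⁻¹ * A1 = 1 := Matrix.nonsing_inv_mul _ hA1
  have hDL : D = hMul C₀ ι A1⁻¹ * L - hMul C₀ ι (A1⁻¹ * A0) := by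
    rw [hLdef, mul_add, ← mul_assoc, ← map_mul, ← map_mul, hinv, map_one, one_mul]
    abel
  set B : Module.End C₀ (Fin 2 → E) := ∑ j ∈ Finset.range (n+1), hMul C₀ ι (Bc j) * D ^ j with hBdef
  have hLf : (⇑L : (Fin 2 → E) → (Fin 2 → E)) = opP ι dE A0 A1 := rfl
  have hDf : (⇑D : (Fin 2 → E) → (Fin 2 → E)) = dVec dE := rfl
  have hBa : ∀ ψ, B ψ = opQ ι dE n Bc ψ := by
    intro ψ
    rw [hBdef, opQ, LinearMap.sum_apply]
    refine Finset.sum_congr rfl fun j _ => ?_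
    rw [Module.End.mul_apply, hMul_apply, Module.End.pow_apply, hDf]
  have hBf : (⇑B : (Fin 2 → E) → (Fin 2 → E)) = opQ ι dE n Bc := funext hBa
  have hLB : Commute L B := by
    refine LinearMap.ext fun ψ => ?_
    rw [Module.End.mul_apply, Module.End.mul_apply, hBf, hLf]
    exact hcomm ψ
  have hcr : ∀ r : C₀[X], Commute (aeval L r) B := by
    intro r
    induction r using Polynomial.induction_on' with
    | add p q hp hq => rw [map_add]; exact hp.add_left hq
    | monomial k c =>
      rw [aeval_monomial]
      exact (show Commute _ _ from Algebra.commutes c B).mul_left (hLB.pow_left k)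
  set ρ : C₀[X][X] →+* Module.End C₀ (Fin 2 → E) :=
    Polynomial.eval₂RingHom' (aeval L : C₀[X] →ₐ[C₀] _).toRingHom B hcr with hρ
  have hap : ∀ g ψ, applyPoly (ι.comp jC) (opP ι dE A0 A1) (opQ ι dE n Bc) g ψ = ρ g ψ := by
    intro g ψ
    have : ρ g = Polynomial.eval₂ (aeval L : C₀[X] →ₐ[C₀] _).toRingHom B g := rfl
    rw [this, Polynomial.eval₂_eq_sum_range, LinearMap.sum_apply, applyPoly]
    refine Finset.sum_congr rfl fun i _ => ?_
    rw [Module.End.mul_apply]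
    have h2 : (aeval L : C₀[X] →ₐ[C₀] _).toRingHom (g.coeff i) = aeval L (g.coeff i) := rfl
    rw [h2, Polynomial.aeval_eq_sum_range, LinearMap.sum_apply]
    refine Finset.sum_congr rfl fun k _ => ?_
    rw [LinearMap.smul_apply, Module.End.pow_apply, Module.End.pow_apply, hLf, hBf,
      ← algebraMap_smul E ((g.coeff i).coeff k)]
    rfl
  have hker : ∀ g, (∀ ψ, applyPoly (ι.comp jC) (opP ι dE A0 A1) (opQ ι dE n Bc) g ψ = 0)
      ↔ ρ g = 0 := by
    intro g
    constructor
    · intro h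
      refine LinearMap.ext fun ψ => ?_
      rw [← hap, h]; rfl
    · intro h ψ
      rw [hap, h]; rfl
  have hf0 : ρ fC = 0 := (hker fC).1 hfBC
  intro g
  rw [hker]
  constructor
  swap
  · rintro ⟨q, rfl⟩
    rw [map_mul, hf0, zero_mul]
  intro hg
  obtain ⟨hmon, hdeg⟩ := fC_monic jC dK A0 A1 n Bc fC hfC
  rw [← Polynomial.modByMonic_eq_zero_iff_dvd hmon]
  set r := g %ₘ fC with hr
  have hr0 : ρ r = 0 := by
    have := Polynomial.modByMonic_add_div g fC
    rw [← this, map_add, map_mul, hf0, zero_mul, add_zero] at hg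
    exact hg
  have hrdeg : r.natDegree ≤ 1 := by
    have : r.natDegree < fC.natDegree :=
      Polynomial.natDegree_modByMonic_lt g hmon (by
        intro h; rw [h] at hdeg; simp at hdeg)
    omega
  have hrX := Polynomial.eq_X_add_C_of_natDegree_le_one hrdeg
  set r1 := r.coeff 1
  set r0 := r.coeff 0
  have hop : aeval L r1 * B + aeval L r0 = 0 := by
    rw [hrX] at hr0
    rw [map_add, map_mul] at hr0
    have e1 : ∀ p, ρ (Polynomial.C p) = aeval L p := by
      intro p
      exact Polynomial.eval₂_C _ _
    have e2 : ρ Polynomial.X = B := Polynomial.eval₂_X _ _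
    rwa [e1, e1, e2] at hr0
  obtain ⟨S, hS⟩ := rep_B (C₀ := C₀) dK ι L D A0 A1 hDm hDL (n+1) Bc
  rw [← hBdef] at hS
  have hLconst : ∀ c : E, dE c = 0 → ∀ φ : Fin 2 → E, L (c • φ) = c • L φ := by
    intro c hc0 φ
    have : dVec dE (c • φ) = c • dVec dE φ := by
      funext i
      simp [dVec, hdE.2, hc0]
    rw [hLa, hLa, opP, opP, this, Matrix.mulVec_smul, Matrix.mulVec_smul, smul_add]
  -- eigenvectors
  have hmapinv : (A1.map ι) * (A1⁻¹.map ι) = 1 := by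
    rw [← Matrix.map_mul, Matrix.mul_nonsing_inv _ hA1, Matrix.map_one _ (map_zero _) (map_one _)]
  have heig : ∀ i, L (fun a => Ψ a i) = lam • (fun a => Ψ a i) := by
    intro i
    have h1 : dVec dE (fun a => Ψ a i) = (NlamE ι lam A0 A1).mulVec (fun a => Ψ a i) := by
      funext a
      exact congrFun (congrFun hΨ a) i
    rw [hLa, opP, h1, Matrix.mulVec_mulVec, NlamE, mul_neg, ← mul_assoc, hmapinv, one_mul, neg_sub,
      Matrix.sub_mulVec, Matrix.smul_mulVec, Matrix.one_mulVec]
    abel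
  set e1 := aeval lam r1 with he1
  set e0 := aeval lam r0 with he0
  set s := matPolyEquiv.symm S with hs
  set W := s.map (eval₂RingHom ι lam) with hW
  have hcol : ∀ i, (e1 • W + e0 • (1 : Matrix (Fin 2) (Fin 2) E)).mulVec (fun a => Ψ a i) = 0 := by
    intro i
    have hp := pow_eig L lam (hLconst lam hlam) _ (heig i)
    have hce1 : dE e1 = 0 := const_aeval dE hdE hc lam hlam r1
    have heig' : L (e1 • (fun a => Ψ a i)) = lam • (e1 • (fun a => Ψ a i)) := by
      rw [hLconst e1 hce1, heig, smul_comm]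
    have hp' := pow_eig L lam (hLconst lam hlam) _ heig'
    have h := congrArg (fun T : Module.End C₀ (Fin 2 → E) => T (fun a => Ψ a i)) hop
    simp only [LinearMap.add_apply, LinearMap.zero_apply] at h
    rw [(hcr r1).eq, Module.End.mul_apply, ev_aeval L lam _ hp, ev_aeval L lam _ hp, ← he1, ← he0,
      hS, ev_rep ι L lam _ hp', Matrix.mulVec_smul] at h
    rw [Matrix.add_mulVec, Matrix.smul_mulVec, Matrix.smul_mulVec, Matrix.one_mulVec]
    exact h
  have hW0 : e1 • W + e0 • (1 : Matrix (Fin 2) (Fin 2) E) = 0 := by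
    have h : (e1 • W + e0 • (1 : Matrix (Fin 2) (Fin 2) E)) * Ψ = 0 := by
      ext a i
      exact congrFun (hcol i) a
    have := congrArg (· * Ψ⁻¹) h
    simpa [Matrix.mul_assoc, Matrix.mul_nonsing_inv _ hΨu] using this
  have hinjl : Function.Injective (eval₂RingHom ι lam) := by
    intro p q hpq
    have : evalLM ι lam mu (Polynomial.C p) = evalLM ι lam mu (Polynomial.C q) := by
      simpa [evalLM] using hpq
    exact Polynomial.C_injective (halg this)
  have hae : ∀ p : C₀[X], aeval lam p = eval₂RingHom ι lam (p.map jC) := by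
    intro p
    rw [coe_eval₂RingHom, Polynomial.eval₂_map]
    rfl
  have hent : ∀ a b, r1.map jC * s a b + r0.map jC * (1 : Matrix (Fin 2) (Fin 2) K[X]) a b = 0 := by
    intro a b
    apply hinjl
    have h := congrFun (congrFun hW0 a) b
    rw [map_add, map_mul, map_mul, map_zero, ← hae, ← hae]
    simp only [Matrix.add_apply, Matrix.smul_apply, Matrix.zero_apply, smul_eq_mul, hW,
      Matrix.map_apply] at h
    rw [← h]
    congr 2
    rw [Matrix.one_apply, Matrix.one_apply]
    split_ifs <;> simp
  by_cases hr1 : r1 = 0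
  · have h := hent 0 0
    rw [hr1] at h
    simp at h
    have hr00 : r0 = 0 := by
      apply Polynomial.map_injective jC jC.injective
      simpa using h
    rw [hrX, hr1, hr00]
    simp
  · exfalso
    apply hnot
    have hm1 : r1.map jC ≠ 0 := by
      rwa [Ne, Polynomial.map_eq_zero]
    have hdvd : r1 ∣ r0 := by
      rw [← Polynomial.map_dvd_map' jC]
      refine ⟨- s 0 0, ?_⟩
      have h := hent 0 0
      rw [Matrix.one_apply_eq] at h
      linear_combination h
    obtain ⟨t, ht⟩ := hdvd
    have hst : ∀ a b, s a b = (-t).map jC * (1 : Matrix (Fin 2) (Fin 2) K[X]) a b := by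
      intro a b
      apply mul_left_cancel₀ hm1
      have h := hent a b
      rw [ht, Polynomial.map_mul] at h
      rw [Polynomial.map_neg]
      linear_combination h
    have hSR : S = (-t).map ((algebraMap K (Matrix (Fin 2) (Fin 2) K)).comp jC) := by
      have hSs : S = matPolyEquiv s := by simp [hs]
      ext k a b
      rw [hSs, matPolyEquiv_coeff_apply, hst, Polynomial.coeff_map, RingHom.comp_apply,
        Matrix.algebraMap_matrix_apply, Matrix.one_apply]
      split_ifs
      · simp
      · simp
    have hBR : B = aeval L (-t) := by
      rw [hS, hSR, Polynomial.eval₂_map, Polynomial.aeval_def]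
      congr 1
      refine RingHom.ext fun c => LinearMap.ext fun x => ?_
      funext i
      rw [Module.algebraMap_end_apply, RingHom.comp_apply, hMul_apply, RingHom.comp_apply,
        Pi.smul_apply, Algebra.smul_def, ham]
      fin_cases i <;> simp [Matrix.mulVec, dotProduct, Fin.sum_univ_two, Matrix.algebraMap_matrix_apply]
    refine ⟨-t, fun ψ => ?_⟩
    rw [← hBa, hBR, Polynomial.aeval_eq_sum_range, LinearMap.sum_apply]
    refine Finset.sum_congr rfl fun k _ => ?_
    rw [LinearMap.smul_apply, Module.End.pow_apply, hLf, ← algebraMap_smul E]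
    rfl
end

section
/- (AKNS commutation.) Let K be a differential field of characteristic zero containing an element i with i² = −1 and elements u, v satisfying the stationary NLS system u″ + 2u²v = 0 and v″ + 2v²u = 0. Define the 2×2 MODOs L = A_0 + A_1 D and B = B_0 + B_1 D + B_2 D² with A_0 = i·[[0,u],[v,0]], A_1 = i·[[1,0],[0,−1]], B_0 = i·[[−uv,−u′],[−v′,uv]], B_1 = i·[[0,−2u],[−2v,0]], B_2 = i·[[−2,0],[0,2]]. Then: (i) for every differential field extension Σ of K, L̂ ∘ B̂ = B̂ ∘ L̂ on Σ², where L̂(ψ) = A_0ψ + A_1ψ′ and B̂(ψ) = B_0ψ + B_1ψ′ + B_2ψ″; and (ii) the elements I_0 = u²v² + v′u′ and I_1 = −2i·v′u + 2i·u′v are constants of K, i.e., ∂I_0 = 0 and ∂I_1 = 0. -/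
open Matrix Polynomial Finset

/-- The AKNS operator `L`: coefficient `A₀ = i·[[0,u],[v,0]]`. -/
def aknsA0 {K : Type*} [Field K] (i u v : K) : Matrix (Fin 2) (Fin 2) K :=
  !![0, i * u; i * v, 0]

/-- The AKNS operator `L`: leading coefficient `A₁ = i·[[1,0],[0,-1]]`. -/
def aknsA1 {K : Type*} [Field K] (i : K) : Matrix (Fin 2) (Fin 2) K :=
  !![i, 0; 0, -i]

/-- The coefficients `B₀, B₁, B₂` of the AKNS operator `B = B₀ + B₁ D + B₂ D²`. -/
def aknsBc {K : Type*} [Field K] (dK : K → K) (i u v : K) :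
    ℕ → Matrix (Fin 2) (Fin 2) K := fun j =>
  if j = 0 then !![-(i * (u * v)), -(i * dK u); -(i * dK v), i * (u * v)]
  else if j = 1 then !![0, -(2 * i * u); -(2 * i * v), 0]
  else if j = 2 then !![-(2 * i), 0; 0, 2 * i]
  else 0

theorem akns_aux {R : Type*} [Field R] (d : R → R) (hd : IsDeriv d) :
    d 0 = 0 ∧ (∀ a, d (-a) = - d a) ∧ d 2 = 0 := by
  obtain ⟨ha, hm⟩ := hd
  have h0 : d 0 = 0 := by have := ha 0 0; simpa using this
  have h1 : d 1 = 0 := by have := hm 1 1; simpa using this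
  refine ⟨h0, ?_, ?_⟩
  · intro a
    have := ha a (-a)
    rw [add_neg_cancel, h0] at this
    linear_combination -this
  · have := ha 1 1
    rw [one_add_one_eq_two, h1] at this
    simpa using this

/-- AKNS commutation: for NLS potentials `u, v`, the AKNS operators `L` and
`B` commute on every differential field extension, and `I₀ = u²v² + v'u'`,
`I₁ = -2i v'u + 2i u'v` are constants of `K`. -/
theorem statement18 {K : Type*} [Field K] [CharZero K]
    (dK : K → K) (hdK : IsDeriv dK) (i u v : K) (hi : i ^ 2 = -1)
    (hu : dK (dK u) + 2 * u ^ 2 * v = 0) (hv : dK (dK v) + 2 * v ^ 2 * u = 0) :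
    (∀ (S : Type*) [Field S] (dS : S → S) (ι : K →+* S), IsDeriv dS →
      (∀ a : K, dS (ι a) = ι (dK a)) →
      ∀ ψ : Fin 2 → S,
        opP ι dS (aknsA0 i u v) (aknsA1 i) (opQ ι dS 2 (aknsBc dK i u v) ψ)
          = opQ ι dS 2 (aknsBc dK i u v) (opP ι dS (aknsA0 i u v) (aknsA1 i) ψ))
    ∧ dK (u ^ 2 * v ^ 2 + dK v * dK u) = 0
    ∧ dK (-(2 * i * dK v * u) + 2 * i * dK u * v) = 0 := by
  obtain ⟨h0, hn, h2⟩ := akns_aux dK hdK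
  have hi0 : i ≠ 0 := by rintro rfl; norm_num at hi
  have hdi : dK i = 0 := by
    have h := hdK.2 i i
    have h1 : dK 1 = 0 := by have := hdK.2 1 1; simpa using this
    rw [← pow_two, hi, hn, h1] at h
    have h3 : (2 * i) * dK i = 0 := by linear_combination -h
    exact (mul_eq_zero.mp h3).resolve_left (mul_ne_zero two_ne_zero hi0)
  refine ⟨?_, ?_, ?_⟩
  · intro S _ dS ι hdS hι ψ
    obtain ⟨s0, sn, s2⟩ := akns_aux dS hdS
    have si : dS (ι i) = 0 := by rw [hι, hdi, map_zero]
    have I2 : ι i ^ 2 = -1 := by rw [← map_pow, hi, map_neg, map_one]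
    have T : ι 2 = 2 := map_ofNat ι 2
    have U : ι (dK (dK u)) = - (2 * ι u ^ 2 * ι v) := by
      rw [eq_neg_of_add_eq_zero_left hu]; simp [T]
    have V : ι (dK (dK v)) = - (2 * ι v ^ 2 * ι u) := by
      rw [eq_neg_of_add_eq_zero_left hv]; simp [T]
    obtain ⟨sa, sm⟩ := hdS
    funext j
    fin_cases j <;>
    · simp [opP, opQ, aknsA0, aknsA1, aknsBc, dVec, Finset.sum_range_succ, Matrix.mulVec,
        dotProduct, Fin.sum_univ_two, sa, sm, sn, s0, s2, si, hι, U, V, T, h2, hdi]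
      ring
  · simp only [pow_two, hdK.1, hdK.2]
    linear_combination dK u * hv + dK v * hu
  · simp only [hdK.1, hdK.2, hn, hdi, h2]
    linear_combination 2 * i * v * hu - 2 * i * u * hv
end
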